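/- arXiv:1110.0385 — 2 statements merged into one kernel-verified Lean document; each statement's English description precedes it below -/
import Mathlib

section
/- Let E be a separable Banach space and for each λ>0 let {R^{(λ)}(t,s)}_{t≥s≥0} be an evolution system on E. Assume: (A1) there are M≥1 and ω∈ℝ such that ‖R^{(λ)}(t,s)‖ ≤ M e^{ω(t−s)} for all t≥s≥0 and all λ>0; (A2) there exists a C₀ semigroup {Ŝ(t)}_{t≥0} on E such that for every ū∈E and t≥s≥0 one has R^{(λ)}(t,s)v̄ → Ŝ(t−s)ū as λ→0⁺ and v̄→ū, uniformly with respect to t,s from bounded intervals; (A3) F : [0,∞)×E → E is continuous, Lipschitz with respect to the second variable on bounded subsets (uniformly in t), and there is c>0 with ‖F(t,v)‖ ≤ c(1+‖v‖) for all t≥0, v∈E; (A4) for each ū∈E the set {F(t,ū) : t≥0} is relatively compact, and there is a locally Lipschitz map F̂ : E → E such that for every ū∈E, F̂(ū) = lim_{T→+∞, v̄→ū} (1/T)∫₀^T F(τ+h, v̄) dτ, uniformly with respect to h>0. Then for any sequences λ_n → 0⁺ in (0,∞) and ū_n → ū₀ in E, the mild solutions u_n : [0,∞) → E (relative to R^{(λ_n)})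 of u_n(t) = R^{(λ_n)}(t,0)ū_n + ∫₀^t R^{(λ_n)}(t,s) F(s/λ_n, u_n(s)) ds converge, uniformly on bounded intervals of [0,∞), to the unique continuous function û : [0,∞) → E satisfying û(t) = Ŝ(t)ū₀ + ∫₀^t Ŝ(t−s) F̂(û(s)) ds. -/
open MeasureTheory Filter Set Topology
open scoped ENNReal

/-- An evolution system on a Banach space `E`: a two-parameter family of bounded linear
operators `R t s` (for `t ≥ s ≥ 0`) with `R t t = I`, the cocycle property, and strong
continuity in `(t, s)`. -/
def IsEvolutionSystem {E : Type*} [NormedAddCommGroup E] [NormedSpace ℝ E]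
    (R : ℝ → ℝ → E →L[ℝ] E) : Prop :=
  (∀ t : ℝ, 0 ≤ t → R t t = ContinuousLinearMap.id ℝ E) ∧
  (∀ t s r : ℝ, 0 ≤ r → r ≤ s → s ≤ t → (R t s).comp (R s r) = R t r) ∧
  (∀ u : E, ContinuousOn (fun p : ℝ × ℝ => R p.1 p.2 u) {p : ℝ × ℝ | 0 ≤ p.2 ∧ p.2 ≤ p.1})

/-- A `C₀` semigroup of bounded linear operators on `E`. -/
def IsC0Semigroup {E : Type*} [NormedAddCommGroup E] [NormedSpace ℝ E]
    (S : ℝ → E →L[ℝ] E) : Prop :=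
  S 0 = ContinuousLinearMap.id ℝ E ∧
  (∀ t s : ℝ, 0 ≤ t → 0 ≤ s → S (t + s) = (S t).comp (S s)) ∧
  (∀ u : E, ContinuousOn (fun t : ℝ => S t u) (Set.Ici 0))


lemma av_gronwall (g : ℝ → ℝ) (hg : Continuous g) (A B T : ℝ) (hB : 0 ≤ B)
    (h : ∀ t ∈ Icc (0:ℝ) T, g t ≤ A + B * ∫ s in (0:ℝ)..t, g s) :
    ∀ t ∈ Icc (0:ℝ) T, g t ≤ A * Real.exp (B * t) := by
  have hd : ∀ t : ℝ, HasDerivAt (fun t => (A + B * ∫ s in (0:ℝ)..t, g s) * Real.exp (-(B * t)))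
      ((B * g t) * Real.exp (-(B * t)) +
        (A + B * ∫ s in (0:ℝ)..t, g s) * (Real.exp (-(B * t)) * (-(B * 1)))) t := by
    intro t
    have h1 : HasDerivAt (fun t => ∫ s in (0:ℝ)..t, g s) (g t) t :=
      intervalIntegral.integral_hasDerivAt_right (hg.intervalIntegrable _ _)
        hg.aestronglyMeasurable.stronglyMeasurableAtFilter hg.continuousAt
    have h2 : HasDerivAt (fun t => Real.exp (-(B * t))) (Real.exp (-(B * t)) * (-(B * 1))) t :=
      (((hasDerivAt_id t).const_mul B).neg).exp
    exact ((h1.const_mul B).const_add A).mul h2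
  have hanti : AntitoneOn (fun t => (A + B * ∫ s in (0:ℝ)..t, g s) * Real.exp (-(B * t)))
      (Icc 0 T) := by
    apply antitoneOn_of_deriv_nonpos (convex_Icc 0 T)
    · exact fun t _ => (hd t).continuousAt.continuousWithinAt
    · exact fun t _ => (hd t).differentiableAt.differentiableWithinAt
    · intro t ht
      rw [interior_Icc] at ht
      rw [(hd t).deriv]
      have := h t ⟨ht.1.le, ht.2.le⟩
      have e := Real.exp_pos (-(B * t))
      have : B * Real.exp (-(B * t)) * (g t - (A + B * ∫ s in (0:ℝ)..t, g s)) ≤ 0 :=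
        mul_nonpos_of_nonneg_of_nonpos (by positivity) (by linarith)
      nlinarith
  intro t ht
  have h0 := hanti (⟨le_refl _, ht.1.trans ht.2⟩ : (0:ℝ) ∈ Icc 0 T) ht ht.1
  simp only [intervalIntegral.integral_same, mul_zero, add_zero, neg_zero, Real.exp_zero,
    mul_one] at h0
  refine (h t ht).trans ?_
  have e := Real.exp_pos (B * t)
  have : (A + B * ∫ s in (0:ℝ)..t, g s) =
      (A + B * ∫ s in (0:ℝ)..t, g s) * Real.exp (-(B * t)) * Real.exp (B * t) := by
    rw [mul_assoc, ← Real.exp_add]; simp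
  rw [this]
  exact mul_le_mul_of_nonneg_right h0 e.le

lemma av_jointcont {E : Type*} [NormedAddCommGroup E] [NormedSpace ℝ E] {X : Type*}
    [TopologicalSpace X] (A : X → E →L[ℝ] E) (hA : ∀ x, Continuous (fun p => A p x))
    (g : X → ℝ) (hg : Continuous g) (hAg : ∀ p, ‖A p‖ ≤ g p) :
    Continuous (fun q : X × E => A q.1 q.2) := by
  rw [continuous_iff_continuousAt]
  rintro ⟨p0, x0⟩
  rw [ContinuousAt, tendsto_iff_norm_sub_tendsto_zero]
  have hlim : Tendsto (fun q : X × E => g q.1 * ‖q.2 - x0‖ + ‖A q.1 x0 - A p0 x0‖) (𝓝 (p0, x0))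
      (𝓝 0) := by
    have : Continuous (fun q : X × E => g q.1 * ‖q.2 - x0‖ + ‖A q.1 x0 - A p0 x0‖) := by
      have h1 := (hA x0).comp (continuous_fst : Continuous (Prod.fst : X × E → X))
      have h2 := hg.comp (continuous_fst : Continuous (Prod.fst : X × E → X))
      exact (h2.mul (continuous_snd.sub continuous_const).norm).add (h1.sub continuous_const).norm
    have := this.tendsto (p0, x0)
    simpa using this
  refine squeeze_zero (fun _ => norm_nonneg _) ?_ hlim
  rintro ⟨p, x⟩
  have : A p x - A p0 x0 = A p (x - x0) + (A p x0 - A p0 x0) := by simp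
  simp only
  rw [this]
  refine (norm_add_le _ _).trans ?_
  gcongr
  exact ((A p).le_opNorm _).trans (by gcongr; exact hAg p)

lemma av_weighted {E : Type*} [NormedAddCommGroup E] [NormedSpace ℝ E]
    (S : ℝ → E →L[ℝ] E) (M ω : ℝ) (hM : 0 ≤ M) (hS : ∀ t ≥ 0, ‖S t‖ ≤ M * Real.exp (ω * t))
    (a : ℝ) (ha : 0 < a) (D : ℝ) (hD : 0 ≤ D) (h : ℝ → E)
    (hh : ∀ s ≥ 0, ‖h s‖ ≤ D * Real.exp ((ω + a) * s)) (t : ℝ) (ht : 0 ≤ t) :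
    Real.exp (-((ω + a) * t)) * ‖∫ s in (0:ℝ)..t, S (t - s) (h s)‖ ≤ M * D / a := by
  have h1 : ‖∫ s in (0:ℝ)..t, S (t - s) (h s)‖ ≤
      ∫ s in (0:ℝ)..t, M * D * Real.exp (ω * t) * Real.exp (a * s) := by
    apply intervalIntegral.norm_integral_le_of_norm_le ht
    · refine Eventually.of_forall fun s hs => ?_
      calc ‖S (t - s) (h s)‖ ≤ ‖S (t - s)‖ * ‖h s‖ := (S (t-s)).le_opNorm _
        _ ≤ (M * Real.exp (ω * (t - s))) * (D * Real.exp ((ω + a) * s)) :=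
          mul_le_mul (hS _ (by linarith [hs.2])) (hh s hs.1.le) (norm_nonneg _) (by positivity)
        _ = M * D * (Real.exp (ω * (t - s)) * Real.exp ((ω + a) * s)) := by ring
        _ = M * D * (Real.exp (ω * t) * Real.exp (a * s)) := by
          rw [← Real.exp_add, ← Real.exp_add]; congr 2; ring
        _ = _ := by ring
    · exact Continuous.intervalIntegrable (by fun_prop) _ _
  have h2 : ∫ s in (0:ℝ)..t, M * D * Real.exp (ω * t) * Real.exp (a * s) =
      M * D * Real.exp (ω * t) * ((Real.exp (a * t) - 1) / a) := by
    rw [intervalIntegral.integral_const_mul]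
    congr 1
    rw [intervalIntegral.integral_comp_mul_left (fun x => Real.exp x) ha.ne', integral_exp]
    simp; field_simp
  rw [h2] at h1
  calc Real.exp (-((ω + a) * t)) * ‖∫ s in (0:ℝ)..t, S (t - s) (h s)‖
      ≤ Real.exp (-((ω + a) * t)) * (M * D * Real.exp (ω * t) * ((Real.exp (a * t)) / a)) := by
        gcongr
        refine h1.trans ?_
        gcongr
        linarith
    _ = M * D / a * (Real.exp (-((ω + a) * t)) * (Real.exp (ω * t) * Real.exp (a * t))) := by ring
    _ = M * D / a := by
      rw [← Real.exp_add, ← Real.exp_add]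
      have : (-((ω + a) * t) + (ω * t + a * t)) = 0 := by ring
      rw [this]; simp

lemma av_exist_global {E : Type*} [NormedAddCommGroup E] [NormedSpace ℝ E] [CompleteSpace E]
    (S : ℝ → E →L[ℝ] E) (hSc : Continuous fun p : ℝ × E => S p.1 p.2)
    (M ω : ℝ) (hM : 0 ≤ M) (hω : 0 ≤ ω) (hS : ∀ t ≥ 0, ‖S t‖ ≤ M * Real.exp (ω * t))
    (G : E → E) (K : ℝ) (hK : 0 ≤ K) (hG : ∀ x y, ‖G x - G y‖ ≤ K * ‖x - y‖) (x0 : E) :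
    ∃ v : ℝ → E, Continuous v ∧ ∀ t ≥ 0, v t = S t x0 + ∫ s in (0:ℝ)..t, S (t - s) (G (v s)) := by
  obtain ⟨a, ha⟩ : ∃ a, a = 2 * M * K + 1 := ⟨_, rfl⟩
  have ha0 : 0 < a := by rw [ha]; positivity
  have hGc : Continuous G :=
    (LipschitzWith.of_dist_le_mul (K := ⟨K, hK⟩) (fun x y => by
      rw [dist_eq_norm, dist_eq_norm]; exact hG x y)).continuous
  let Q : (BoundedContinuousFunction ℝ E) → ℝ → E := fun w t =>
    Real.exp (-((ω + a) * max t 0)) • (S (max t 0) x0 +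
      ∫ s in (0:ℝ)..(max t 0), S (max t 0 - s) (G (Real.exp ((ω + a) * s) • w s)))
  have hint : ∀ (w : BoundedContinuousFunction ℝ E),
      Continuous (fun p : ℝ × ℝ => S (p.1 - p.2) (G (Real.exp ((ω + a) * p.2) • w p.2))) := by
    intro w
    have hw := w.continuous
    exact hSc.comp ((continuous_fst.sub continuous_snd).prodMk (hGc.comp (by fun_prop)))
  have hQc : ∀ w, Continuous (Q w) := by
    intro w
    have hm : Continuous (fun t : ℝ => max t 0) := by fun_prop
    have h1 : Continuous (fun t : ℝ => S (max t 0) x0) := hSc.comp (hm.prodMk continuous_const)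
    have h2 : Continuous (fun t : ℝ => ∫ s in (0:ℝ)..t,
        S (t - s) (G (Real.exp ((ω + a) * s) • w s))) :=
      intervalIntegral.continuous_parametric_intervalIntegral_of_continuous (hint w) continuous_id
    exact Continuous.smul (by fun_prop) (h1.add (h2.comp hm))
  have hQb : ∀ (w : BoundedContinuousFunction ℝ E) (t : ℝ),
      ‖Q w t‖ ≤ M * ‖x0‖ + M * (‖G 0‖ + K * ‖w‖) / a := by
    intro w t
    have ht : 0 ≤ max t 0 := le_max_right _ _
    have hw := av_weighted S M ω hM hS a ha0 (‖G 0‖ + K * ‖w‖) (by positivity)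
      (fun s => G (Real.exp ((ω + a) * s) • w s)) (by
        intro s hs
        have e1 : 1 ≤ Real.exp ((ω + a) * s) := Real.one_le_exp (by positivity)
        have := hG (Real.exp ((ω + a) * s) • w s) 0
        have h3 : ‖G (Real.exp ((ω + a) * s) • w s)‖ ≤ ‖G 0‖ + K * (Real.exp ((ω + a) * s) * ‖w‖) := by
          calc _ = ‖G 0 + (G (Real.exp ((ω + a) * s) • w s) - G 0)‖ := by congr 1; abel
            _ ≤ _ := norm_add_le _ _
            _ ≤ ‖G 0‖ + K * ‖Real.exp ((ω + a) * s) • w s - 0‖ := by gcongr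
            _ ≤ _ := by
              rw [sub_zero, norm_smul, Real.norm_of_nonneg (Real.exp_pos _).le]
              gcongr
              exact w.norm_coe_le_norm s
        have := norm_nonneg (G 0)
        nlinarith) (max t 0) ht
    simp only [Q]
    rw [norm_smul, Real.norm_of_nonneg (Real.exp_pos _).le]
    refine (mul_le_mul_of_nonneg_left (norm_add_le _ _) (Real.exp_pos _).le).trans ?_
    rw [mul_add]
    refine add_le_add ?_ hw
    have h5 : ‖S (max t 0) x0‖ ≤ M * Real.exp (ω * max t 0) * ‖x0‖ :=
      ((S _).le_opNorm _).trans (by gcongr; exact hS _ ht)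
    calc Real.exp (-((ω + a) * max t 0)) * ‖S (max t 0) x0‖
        ≤ Real.exp (-((ω + a) * max t 0)) * (M * Real.exp (ω * max t 0) * ‖x0‖) := by gcongr
      _ = M * ‖x0‖ * (Real.exp (-((ω + a) * max t 0)) * Real.exp (ω * max t 0)) := by ring
      _ ≤ M * ‖x0‖ * 1 := by
        gcongr
        rw [← Real.exp_add]
        apply Real.exp_le_one_iff.2
        nlinarith
      _ = _ := by ring
  let Ψ : BoundedContinuousFunction ℝ E → BoundedContinuousFunction ℝ E := fun w =>
    BoundedContinuousFunction.ofNormedAddCommGroup (Q w) (hQc w) _ (hQb w)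
  have hΨ : ContractingWith (1/2 : NNReal) Ψ := by
    refine ⟨by rw [← NNReal.coe_lt_coe]; norm_num, LipschitzWith.of_dist_le_mul ?_⟩
    intro w w'
    rw [BoundedContinuousFunction.dist_le (by positivity)]
    intro t
    have ht : 0 ≤ max t 0 := le_max_right _ _
    have hw := av_weighted S M ω hM hS a ha0 (K * dist w w') (by positivity)
      (fun s => G (Real.exp ((ω + a) * s) • w s) - G (Real.exp ((ω + a) * s) • w' s)) (by
        intro s hs
        refine (hG _ _).trans ?_
        rw [← smul_sub, norm_smul, Real.norm_of_nonneg (Real.exp_pos _).le, ← dist_eq_norm]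
        have := BoundedContinuousFunction.dist_coe_le_dist (f := w) (g := w') s
        calc K * (Real.exp ((ω + a) * s) * dist (w s) (w' s)) ≤
          K * (Real.exp ((ω + a) * s) * dist w w') := by gcongr
          _ = _ := by ring) (max t 0) ht
    have e : Q w t - Q w' t = Real.exp (-((ω + a) * max t 0)) •
      ∫ s in (0:ℝ)..(max t 0), S (max t 0 - s) (G (Real.exp ((ω + a) * s) • w s) -
        G (Real.exp ((ω + a) * s) • w' s)) := by
      simp only [Q]
      rw [← smul_sub, add_sub_add_left_eq_sub, ← intervalIntegral.integral_sub]
      · simp only [map_sub]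
      · exact ((hint w).comp (continuous_const.prodMk continuous_id)).intervalIntegrable _ _
      · exact ((hint w').comp (continuous_const.prodMk continuous_id)).intervalIntegrable _ _
    change dist (Q w t) (Q w' t) ≤ _
    rw [dist_eq_norm, e, norm_smul, Real.norm_of_nonneg (Real.exp_pos _).le]
    refine hw.trans ?_
    have hd : 0 ≤ dist w w' := dist_nonneg
    rw [div_le_iff₀ ha0]
    push_cast
    rw [ha]
    nlinarith
  obtain ⟨w, hw⟩ : ∃ w, Ψ w = w := ⟨_, hΨ.fixedPoint_isFixedPt⟩
  refine ⟨fun t => Real.exp ((ω + a) * t) • w t, ?_, ?_⟩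
  · have := w.continuous
    fun_prop
  · intro t ht
    have h1 : w t = Q w t := by
      conv_lhs => rw [← hw]
      rfl
    simp only
    conv_lhs => rw [h1]
    simp only [Q, max_eq_left ht]
    rw [smul_smul, ← Real.exp_add]
    simp

lemma av_int_bound {E : Type*} [NormedAddCommGroup E] [NormedSpace ℝ E]
    (A : ℝ → E →L[ℝ] E) (h : ℝ → E) (K : ℝ) (hK : 0 ≤ K) (t : ℝ) (ht : 0 ≤ t)
    (hA : ∀ s ∈ Icc 0 t, ‖A s‖ ≤ K) (D L : ℝ) (e : ℝ → ℝ) (he : Continuous e)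
    (hh : ∀ s ∈ Icc 0 t, ‖h s‖ ≤ D + L * e s) :
    ‖∫ s in (0:ℝ)..t, A s (h s)‖ ≤ K * D * t + K * L * ∫ s in (0:ℝ)..t, e s := by
  have h1 : ‖∫ s in (0:ℝ)..t, A s (h s)‖ ≤ ∫ s in (0:ℝ)..t, (K * D + K * L * e s) := by
    apply intervalIntegral.norm_integral_le_of_norm_le ht
    · refine Eventually.of_forall fun s hs => ?_
      have hs' : s ∈ Icc 0 t := ⟨hs.1.le, hs.2⟩
      calc ‖A s (h s)‖ ≤ ‖A s‖ * ‖h s‖ := (A s).le_opNorm _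
        _ ≤ K * (D + L * e s) := mul_le_mul (hA s hs') (hh s hs') (norm_nonneg _) hK
        _ = _ := by ring
    · exact Continuous.intervalIntegrable (by fun_prop) _ _
  refine h1.trans (le_of_eq ?_)
  rw [intervalIntegral.integral_add (Continuous.intervalIntegrable (by fun_prop) _ _)
    (Continuous.intervalIntegrable (by fun_prop) _ _), intervalIntegral.integral_const_mul]
  simp; ring

lemma av_bdd {E : Type*} [NormedAddCommGroup E] (v : ℝ → E) (hv : Continuous v) (T : ℝ) :
    ∃ C > 0, ∀ t ∈ Icc (0:ℝ) T, ‖v t‖ ≤ C := by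
  obtain ⟨C, hC⟩ := isCompact_Icc.exists_bound_of_continuousOn (s := Icc (0:ℝ) T) hv.continuousOn
  exact ⟨max C 1, by positivity, fun t ht => (hC t ht).trans (le_max_left _ _)⟩

lemma av_uniq {E : Type*} [NormedAddCommGroup E] [NormedSpace ℝ E]
    (S : ℝ → E →L[ℝ] E) (hSc : Continuous fun p : ℝ × E => S p.1 p.2)
    (K T : ℝ) (hK : 0 ≤ K) (hS : ∀ t ∈ Icc (0:ℝ) T, ‖S t‖ ≤ K)
    (G : E → E) (hGc : Continuous G)
    (hG : ∀ C > (0:ℝ), ∃ L > (0:ℝ), ∀ x y, ‖x‖ ≤ C → ‖y‖ ≤ C → ‖G x - G y‖ ≤ L * ‖x - y‖)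
    (x0 : E) (v w : ℝ → E) (hv : Continuous v) (hw : Continuous w)
    (hv1 : ∀ t ∈ Icc (0:ℝ) T, v t = S t x0 + ∫ s in (0:ℝ)..t, S (t - s) (G (v s)))
    (hw1 : ∀ t ∈ Icc (0:ℝ) T, w t = S t x0 + ∫ s in (0:ℝ)..t, S (t - s) (G (w s))) :
    ∀ t ∈ Icc (0:ℝ) T, v t = w t := by
  obtain ⟨C1, hC1, hb1⟩ := av_bdd v hv T
  obtain ⟨C2, hC2, hb2⟩ := av_bdd w hw T
  obtain ⟨L, hL, hLip⟩ := hG (max C1 C2) (by positivity)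
  have key := av_gronwall (fun t => ‖v t - w t‖) (by fun_prop) 0 (K * L) T (by positivity) (by
    intro t ht
    have hi : ∀ z : ℝ → E, Continuous z → IntervalIntegrable
        (fun s => S (t - s) (G (z s))) volume 0 t := by
      intro z hz
      exact (hSc.comp ((continuous_const.sub continuous_id).prodMk
        (hGc.comp hz))).intervalIntegrable _ _
    have e : v t - w t = ∫ s in (0:ℝ)..t, S (t - s) (G (v s) - G (w s)) := by
      rw [hv1 t ht, hw1 t ht, add_sub_add_left_eq_sub,
        ← intervalIntegral.integral_sub (hi v hv) (hi w hw)]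
      simp only [map_sub]
    have := av_int_bound (fun s => S (t - s)) (fun s => G (v s) - G (w s)) K hK t ht.1
      (fun s hs => hS _ ⟨by linarith [hs.2], by linarith [hs.1, ht.2]⟩) 0 L
      (fun t => ‖v t - w t‖) (by fun_prop) (by
        intro s hs
        have hs' : s ∈ Icc 0 T := ⟨hs.1, hs.2.trans ht.2⟩
        rw [zero_add]
        exact hLip _ _ ((hb1 s hs').trans (le_max_left _ _)) ((hb2 s hs').trans (le_max_right _ _)))
    rw [e]
    simpa using this)
  intro t ht
  have := key t ht
  simp only [zero_mul] at this
  exact sub_eq_zero.1 (norm_le_zero_iff.1 this)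

lemma av_exist {E : Type*} [NormedAddCommGroup E] [NormedSpace ℝ E] [CompleteSpace E]
    (S : ℝ → E →L[ℝ] E) (hSc : Continuous fun p : ℝ × E => S p.1 p.2)
    (M ω : ℝ) (hM : 0 ≤ M) (hω : 0 ≤ ω) (hS : ∀ t ≥ 0, ‖S t‖ ≤ M * Real.exp (ω * t))
    (G : E → E) (hGc : Continuous G)
    (hG : ∀ C > (0:ℝ), ∃ L > (0:ℝ), ∀ x y, ‖x‖ ≤ C → ‖y‖ ≤ C → ‖G x - G y‖ ≤ L * ‖x - y‖)
    (c : ℝ) (hc : 0 < c) (hgr : ∀ x, ‖G x‖ ≤ c * (1 + ‖x‖))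
    (x0 : E) :
    ∃ v : ℝ → E, Continuous v ∧ ∀ t ≥ 0, v t = S t x0 + ∫ s in (0:ℝ)..t, S (t - s) (G (v s)) := by
  have hSK : ∀ T : ℝ, ∀ t ∈ Icc (0:ℝ) T, ‖S t‖ ≤ M * Real.exp (ω * T) := by
    intro T t ht
    refine (hS t ht.1).trans ?_
    gcongr
    exact ht.2
  have hT : ∀ T : ℝ, ∃ v : ℝ → E, Continuous v ∧
      ∀ t ∈ Icc (0:ℝ) T, v t = S t x0 + ∫ s in (0:ℝ)..t, S (t - s) (G (v s)) := by
    intro T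
    obtain ⟨K, hK⟩ : ∃ K, K = M * Real.exp (ω * T) := ⟨_, rfl⟩
    have hK0 : 0 ≤ K := by rw [hK]; positivity
    obtain ⟨C, hC⟩ : ∃ C, C = (K * ‖x0‖ + K * c * |T|) * Real.exp (K * c * |T|) := ⟨_, rfl⟩
    have hC0 : 0 ≤ C := by rw [hC]; positivity
    obtain ⟨L, hL, hLip⟩ := hG (C + 1) (by positivity)
    let φ : E → ℝ := fun x => max 0 (min 1 (C + 1 - ‖x‖))
    have hφ0 : ∀ x, 0 ≤ φ x := fun x => le_max_left _ _
    have hφ1 : ∀ x, φ x ≤ 1 := fun x => max_le zero_le_one (min_le_left _ _)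
    have hφL : ∀ x y, |φ x - φ y| ≤ ‖x - y‖ := by
      intro x y
      have h1 := abs_norm_sub_norm_le x y
      have h2 : |φ x - φ y| ≤ |(C + 1 - ‖x‖) - (C + 1 - ‖y‖)| := by
        simp only [φ]
        rw [abs_le, abs_eq_max_neg]
        grind
      refine h2.trans ?_
      rw [sub_sub_sub_cancel_left, abs_sub_comm]
      exact h1
    have hφout : ∀ x, C + 1 < ‖x‖ → φ x = 0 := by
      intro x hx
      exact max_eq_left ((min_le_right _ _).trans (by linarith))
    have hφin : ∀ x, ‖x‖ ≤ C → φ x = 1 := by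
      intro x hx
      simp only [φ]
      rw [min_eq_left (by linarith), max_eq_right zero_le_one]
    have aux : ∀ x y, ‖x‖ ≤ C + 1 →
        ‖φ x • G x - φ y • G y‖ ≤ (c * (C + 2) + L) * ‖x - y‖ := by
      intro x y hx
      have e : φ x • G x - φ y • G y = (φ x - φ y) • G x + φ y • (G x - G y) := by
        module
      have h1 : ‖(φ x - φ y) • G x‖ ≤ (c * (C + 2)) * ‖x - y‖ := by
        rw [norm_smul, Real.norm_eq_abs, mul_comm]
        refine mul_le_mul ((hgr x).trans ?_) (hφL x y) (abs_nonneg _) (by positivity)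
        nlinarith
      have h2 : ‖φ y • (G x - G y)‖ ≤ L * ‖x - y‖ := by
        by_cases hy : ‖y‖ ≤ C + 1
        · rw [norm_smul, Real.norm_of_nonneg (hφ0 y)]
          refine (mul_le_of_le_one_left (norm_nonneg _) (hφ1 y)).trans (hLip x y hx hy)
        · rw [hφout y (not_le.1 hy)]; simp; positivity
      rw [e, add_mul]
      exact (norm_add_le _ _).trans (add_le_add h1 h2)
    obtain ⟨v, hvc, hv⟩ := av_exist_global S hSc M ω hM hω hS (fun x => φ x • G x)
      (c * (C + 2) + L) (by positivity) (by
        intro x y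
        by_cases hx : ‖x‖ ≤ C + 1
        · exact aux x y hx
        by_cases hy : ‖y‖ ≤ C + 1
        · rw [norm_sub_rev, norm_sub_rev x y]; exact aux y x hy
        · rw [hφout x (not_le.1 hx), hφout y (not_le.1 hy)]; simp; positivity) x0
    have hb : ∀ t ∈ Icc (0:ℝ) T, ‖v t‖ ≤ C := by
      have := av_gronwall (fun t => ‖v t‖) (by fun_prop) (K * ‖x0‖ + K * c * |T|) (K * c) T
        (by positivity) (by
          intro t ht
          conv_lhs => rw [hv t ht.1]
          refine (norm_add_le _ _).trans ?_
          have h1 : ‖S t x0‖ ≤ K * ‖x0‖ :=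
            ((S t).le_opNorm _).trans (by gcongr; rw [hK]; exact hSK T t ht)
          have h2 := av_int_bound (fun s => S (t - s)) (fun s => φ (v s) • G (v s)) K hK0 t ht.1
            (fun s hs => by
              rw [hK]
              exact hSK T _ ⟨by linarith [hs.2], by linarith [hs.1, ht.2]⟩) c c
            (fun t => ‖v t‖) (by fun_prop) (by
              intro s hs
              rw [norm_smul, Real.norm_of_nonneg (hφ0 _)]
              refine (mul_le_of_le_one_left (norm_nonneg _) (hφ1 _)).trans ((hgr _).trans ?_)
              linarith)
          have h3 : K * c * t ≤ K * c * |T| := by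
            gcongr; exact ht.2.trans (le_abs_self T)
          linarith)
      intro t ht
      refine (this t ht).trans ?_
      rw [hC]
      gcongr
      exact ht.2.trans (le_abs_self T)
    refine ⟨v, hvc, fun t ht => ?_⟩
    rw [hv t ht.1]
    congr 1
    apply intervalIntegral.integral_congr
    intro s hs
    rw [uIcc_of_le ht.1] at hs
    simp only
    rw [hφin _ (hb s ⟨hs.1, hs.2.trans ht.2⟩), one_smul]
  choose V hVc hV using hT
  have hVV : ∀ T T' : ℝ, ∀ t, 0 ≤ t → t ≤ T → t ≤ T' → V T t = V T' t := by
    intro T T' t h0 h1 h2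
    exact av_uniq S hSc _ (min T T') (by positivity) (hSK _) G hGc hG x0 (V T) (V T')
      (hVc _) (hVc _) (fun t ht => hV T t ⟨ht.1, ht.2.trans (min_le_left _ _)⟩)
      (fun t ht => hV T' t ⟨ht.1, ht.2.trans (min_le_right _ _)⟩) t ⟨h0, le_min h1 h2⟩
  refine ⟨fun t => V (max t 0 + 1) (max t 0), ?_, ?_⟩
  · rw [continuous_iff_continuousAt]
    intro t
    have h1 : Continuous (fun s : ℝ => V (max t 0 + 1) (max s 0)) :=
      (hVc _).comp (by fun_prop)
    refine h1.continuousAt.congr ?_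
    have : ∀ᶠ s in 𝓝 t, s < max t 0 + 1 :=
      eventually_lt_nhds (by linarith [le_max_left t 0])
    filter_upwards [this] with s hs
    apply hVV
    · exact le_max_right _ _
    · exact max_le hs.le (by positivity)
    · linarith
  · intro t ht
    simp only
    rw [max_eq_left ht, hV (t+1) t ⟨ht, by linarith⟩]
    congr 1
    apply intervalIntegral.integral_congr
    intro s hs
    rw [uIcc_of_le ht] at hs
    simp only
    rw [max_eq_left hs.1, hVV (t+1) (s+1) s hs.1 (by linarith [hs.2]) (by linarith)]

lemma av_unif {E : Type*} [NormedAddCommGroup E] {ι κ : Type*} (l : Filter ι)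
    (P : ι → κ → Prop) (f : ι → κ → E → E) (B Q : Set E) (hQB : Q ⊆ B) (hQ : TotallyBounded Q)
    (C : ℝ) (hC : 0 ≤ C)
    (hf : ∀ᶠ i in l, ∀ k, P i k → ∀ x ∈ B, ∀ y ∈ B, ‖f i k x - f i k y‖ ≤ C * ‖x - y‖)
    (hp : ∀ x ∈ B, ∀ ε > (0:ℝ), ∀ᶠ i in l, ∀ k, P i k → ‖f i k x‖ ≤ ε) :
    ∀ ε > (0:ℝ), ∀ᶠ i in l, ∀ k, P i k → ∀ x ∈ Q, ‖f i k x‖ ≤ ε := by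
  intro ε hε
  obtain ⟨N, hNQ, hNf, hN⟩ := Metric.finite_approx_of_totallyBounded hQ (ε / (2 * (C + 1)))
    (by positivity)
  have h1 : ∀ᶠ i in l, ∀ y ∈ N, ∀ k, P i k → ‖f i k y‖ ≤ ε / 2 :=
    (eventually_all_finite hNf).2 fun y hy => hp y (hQB (hNQ hy)) _ (by positivity)
  filter_upwards [h1, hf] with i hi hfi k hk x hx
  obtain ⟨y, hy, hxy⟩ := mem_iUnion₂.1 (hN hx)
  rw [Metric.mem_ball, dist_eq_norm] at hxy
  have h2 := hfi k hk x (hQB hx) y (hQB (hNQ hy))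
  have h3 := hi y hy k hk
  have h4 : ‖f i k x‖ ≤ ‖f i k x - f i k y‖ + ‖f i k y‖ := by
    simpa using norm_add_le (f i k x - f i k y) (f i k y)
  have h5 : C * ‖x - y‖ ≤ ε / 2 := by
    calc C * ‖x - y‖ ≤ (C + 1) * (ε / (2 * (C + 1))) := by gcongr; linarith
      _ = ε / 2 := by field_simp
  linarith

lemma av_avg {E : Type*} [NormedAddCommGroup E] [NormedSpace ℝ E]
    (F : ℝ → E → E) (c : ℝ) (hc : 0 < c)
    (hgr : ∀ t v, ‖F t v‖ ≤ c * (1 + ‖v‖)) (Fhat : E → E)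
    (hgr' : ∀ v, ‖Fhat v‖ ≤ c * (1 + ‖v‖)) (v : E)
    (hA4 : ∀ ε > (0:ℝ), ∃ T₀ > (0:ℝ), ∀ T : ℝ, T₀ ≤ T → ∀ h : ℝ, 0 ≤ h →
        ‖(1 / T) • (∫ τ in (0:ℝ)..T, F (τ + h) v) - Fhat v‖ ≤ ε)
    (T : ℝ) (hT : 0 < T) (ε : ℝ) (hε : 0 < ε) :
    ∀ᶠ lam in 𝓝[>] (0:ℝ), ∀ k : ℝ × ℝ, (0 ≤ k.1 ∧ k.1 ≤ k.2 ∧ k.2 ≤ T) →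
      ‖(∫ s in k.1..k.2, F (s / lam) v) - (k.2 - k.1) • Fhat v‖ ≤ ε := by
  obtain ⟨T₀, hT₀, h4⟩ := hA4 (ε / T) (by positivity)
  have hD : 0 < T₀ * (2 * (c * (1 + ‖v‖))) := by positivity
  have hev : ∀ᶠ lam in 𝓝[>] (0:ℝ), lam ∈ Ioo 0 (ε / (T₀ * (2 * (c * (1 + ‖v‖))))) :=
    Ioo_mem_nhdsGT (by positivity)
  filter_upwards [hev] with lam hlam
  rintro ⟨a, b⟩ ⟨ha, hab, hb⟩
  simp only at ha hab hb ⊢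
  have hl := hlam.1
  rcases le_or_gt T₀ ((b - a) / lam) with h | h
  · have hX : 0 < (b - a) / lam := hT₀.trans_le h
    have hba : 0 < b - a := by
      have := mul_pos hX hl
      rwa [div_mul_cancel₀ _ hl.ne'] at this
    have h1 := h4 _ h (a / lam) (by positivity)
    have e1 : (∫ s in a..b, F (s / lam) v) =
        lam • ∫ τ in (0:ℝ)..((b - a) / lam), F (τ + a / lam) v := by
      rw [intervalIntegral.integral_comp_div (fun s => F s v) hl.ne',
        intervalIntegral.integral_comp_add_right (fun s => F s v)]
      congr 2
      · ring
      · field_simp; ring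
    have e2 : lam = (b - a) * (1 / ((b - a) / lam)) := by field_simp
    have e3 : (∫ s in a..b, F (s / lam) v) - (b - a) • Fhat v = (b - a) •
        ((1 / ((b - a) / lam)) • (∫ τ in (0:ℝ)..((b - a) / lam), F (τ + a / lam) v) - Fhat v) := by
      rw [smul_sub, smul_smul, ← e2, e1]
    rw [e3, norm_smul, Real.norm_of_nonneg hba.le]
    calc (b - a) * _ ≤ T * (ε / T) := mul_le_mul (by linarith) h1 (norm_nonneg _) hT.le
      _ = ε := by field_simp
  · have hba : b - a ≤ T₀ * lam := by
      rw [div_lt_iff₀ hl] at h; exact h.le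
    have h0 : 0 ≤ b - a := by linarith
    have h1 : ‖∫ s in a..b, F (s / lam) v‖ ≤ c * (1 + ‖v‖) * |b - a| :=
      intervalIntegral.norm_integral_le_of_norm_le_const (fun s _ => hgr _ _)
    rw [abs_of_nonneg h0] at h1
    have h2 : ‖(b - a) • Fhat v‖ ≤ (b - a) * (c * (1 + ‖v‖)) := by
      rw [norm_smul, Real.norm_of_nonneg h0]
      gcongr; exact hgr' v
    have h3 := hlam.2
    rw [lt_div_iff₀ hD] at h3
    have h5 : (b - a) * (2 * (c * (1 + ‖v‖))) ≤ T₀ * lam * (2 * (c * (1 + ‖v‖))) := by gcongr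
    refine (norm_sub_le _ _).trans ?_
    nlinarith

lemma av_part {E : Type*} [NormedAddCommGroup E] [NormedSpace ℝ E] (g : ℝ → E)
    (hg : Continuous g) (T t : ℝ) (ht : t ∈ Icc 0 T) (m : ℕ) (hm : 0 < m) (η ρ : ℝ) (hη : 0 ≤ η)
    (h : ∀ a b : ℝ, 0 ≤ a → a ≤ b → b ≤ t → b - a ≤ T / m → ‖∫ s in a..b, g s‖ ≤ η * (b - a) + ρ) :
    ‖∫ s in (0:ℝ)..t, g s‖ ≤ η * T + m * ρ := by
  have hm' : (0:ℝ) < m := by exact_mod_cast hm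
  have hs := intervalIntegral.sum_integral_adjacent_intervals (f := g) (μ := volume)
    (a := fun k : ℕ => k * (t / m)) (n := m) (fun k _ => hg.intervalIntegrable _ _)
  have e : (m:ℝ) * (t / m) = t := by field_simp
  simp only [Nat.cast_zero, zero_mul, e] at hs
  have htm : 0 ≤ t / m := div_nonneg ht.1 hm'.le
  rw [← hs]
  calc ‖∑ k ∈ Finset.range m, ∫ x in ((k:ℝ) * (t / m))..(((k+1 : ℕ):ℝ) * (t / m)), g x‖
      ≤ ∑ k ∈ Finset.range m, (η * (t / m) + ρ) := by
        apply norm_sum_le_of_le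
        intro k hk
        have hk' : ((k + 1 : ℕ) : ℝ) ≤ m := by exact_mod_cast Finset.mem_range.1 hk
        have e2 : ((k + 1 : ℕ) : ℝ) * (t / m) - k * (t / m) = t / m := by push_cast; ring
        have := h (k * (t / m)) (((k+1 : ℕ):ℝ) * (t / m)) (by positivity)
          (by linarith) (by
            calc ((k + 1 : ℕ) : ℝ) * (t / m) ≤ m * (t / m) := by gcongr
              _ = t := e) (by rw [e2]; gcongr; exact ht.2)
        rwa [e2] at this
    _ = η * (m * (t / m)) + m * ρ := by
      rw [Finset.sum_const, Finset.card_range, nsmul_eq_mul]; ring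
    _ ≤ _ := by
      rw [e]
      gcongr
      exact ht.2

lemma av_opunif {E : Type*} [NormedAddCommGroup E] [NormedSpace ℝ E] {ι κ : Type*} (l : Filter ι)
    (P : ι → κ → Prop) (A : ι → κ → E →L[ℝ] E) (K : ℝ) (hK : 0 ≤ K)
    (hA : ∀ᶠ i in l, ∀ k, P i k → ‖A i k‖ ≤ K)
    (hp : ∀ x, ∀ ε > (0:ℝ), ∀ᶠ i in l, ∀ k, P i k → ‖A i k x‖ ≤ ε)
    (F : ℝ → E → E) (hF : ∀ v, TotallyBounded (range (fun t => F t v)))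
    (C L : ℝ) (hL : 0 ≤ L)
    (hLip : ∀ t x y, ‖x‖ ≤ C → ‖y‖ ≤ C → ‖F t x - F t y‖ ≤ L * ‖x - y‖)
    (V : Set E) (hV : TotallyBounded V) (hVC : ∀ v ∈ V, ‖v‖ ≤ C) :
    ∀ ε > (0:ℝ), ∀ᶠ i in l, ∀ k, P i k → ∀ τ, ∀ v ∈ V, ‖A i k (F τ v)‖ ≤ ε := by
  have hlip : ∀ᶠ i in l, ∀ k, P i k → ∀ x y, ‖A i k x - A i k y‖ ≤ K * ‖x - y‖ := by
    filter_upwards [hA] with i hi k hk x y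
    rw [← map_sub]
    exact ((A i k).le_opNorm _).trans (by gcongr; exact hi k hk)
  intro ε hε
  have := av_unif l (fun i (k : κ × ℝ) => P i k.1) (fun i k v => A i k.1 (F k.2 v))
    {v | ‖v‖ ≤ C} V hVC hV (K * L) (by positivity) (by
      filter_upwards [hlip] with i hi k hk x hx y hy
      refine (hi k.1 hk _ _).trans ?_
      rw [mul_assoc]
      gcongr
      exact hLip _ _ _ hx hy) (by
      intro x hx ε hε
      have := av_unif l P (fun i k y => A i k y) univ _ (subset_univ _) (hF x) K hK (by
        filter_upwards [hlip] with i hi k hk x _ y _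
        exact hi k hk x y) (fun y _ => hp y) ε hε
      filter_upwards [this] with i hi k hk
      exact hi k.1 hk _ ⟨k.2, rfl⟩) ε hε
  filter_upwards [this] with i hi k hk τ v hv
  exact hi (k, τ) hk v hv

lemma av_W {E : Type*} [NormedAddCommGroup E] [NormedSpace ℝ E] [CompleteSpace E]
    (F : ℝ → E → E) (hFc : Continuous fun p : ℝ × E => F p.1 p.2) (c : ℝ) (hc : 0 < c)
    (hgr : ∀ t v, ‖F t v‖ ≤ c * (1 + ‖v‖)) (Fhat : E → E) (hFhc : Continuous Fhat)
    (hgr' : ∀ v, ‖Fhat v‖ ≤ c * (1 + ‖v‖))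
    (hA4 : ∀ v, ∀ ε > (0:ℝ), ∃ T₀ > (0:ℝ), ∀ T : ℝ, T₀ ≤ T → ∀ h : ℝ, 0 ≤ h →
        ‖(1 / T) • (∫ τ in (0:ℝ)..T, F (τ + h) v) - Fhat v‖ ≤ ε)
    (T : ℝ) (hT : 0 < T) (C L : ℝ) (hL : 0 < L)
    (hLip : ∀ t x y, ‖x‖ ≤ C → ‖y‖ ≤ C → ‖F t x - F t y‖ ≤ L * ‖x - y‖)
    (hLip' : ∀ x y, ‖x‖ ≤ C → ‖y‖ ≤ C → ‖Fhat x - Fhat y‖ ≤ L * ‖x - y‖)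
    (w : ℝ → E) (hw : Continuous w) (hwC : ∀ t ∈ Icc (0:ℝ) T, ‖w t‖ ≤ C)
    (ε : ℝ) (hε : 0 < ε) :
    ∀ᶠ lam in 𝓝[>] (0:ℝ), ∀ t ∈ Icc (0:ℝ) T,
      ‖∫ s in (0:ℝ)..t, (F (s / lam) (w s) - Fhat (w s))‖ ≤ ε := by
  have hFi : ∀ (lam a b : ℝ) (v : E), IntervalIntegrable (fun s => F (s / lam) v) volume a b := by
    intro lam a b v
    exact (hFc.comp ((continuous_id.div_const lam).prodMk continuous_const)).intervalIntegrable _ _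
  have hFw : ∀ (lam : ℝ), Continuous (fun s => F (s / lam) (w s)) := by
    intro lam
    exact hFc.comp ((continuous_id.div_const lam).prodMk hw)
  have hFhw : Continuous (fun s => Fhat (w s)) := hFhc.comp hw
  have hVtb : TotallyBounded (w '' Icc 0 T) := (isCompact_Icc.image hw).totallyBounded
  have huni := av_unif (𝓝[>] (0:ℝ)) (fun _ (k : ℝ × ℝ) => 0 ≤ k.1 ∧ k.1 ≤ k.2 ∧ k.2 ≤ T)
    (fun lam k v => (∫ s in k.1..k.2, F (s / lam) v) - (k.2 - k.1) • Fhat v)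
    {v | ‖v‖ ≤ C} (w '' Icc 0 T) (by rintro _ ⟨t, ht, rfl⟩; exact hwC t ht) hVtb
    (2 * L * T) (by positivity) (by
      refine Eventually.of_forall ?_
      rintro lam ⟨a, b⟩ ⟨ha, hab, hb⟩ x hx y hy
      simp only at ha hab hb ⊢
      have h0 : 0 ≤ b - a := by linarith
      have e : (∫ s in a..b, F (s / lam) x) - (b - a) • Fhat x -
          ((∫ s in a..b, F (s / lam) y) - (b - a) • Fhat y) =
          (∫ s in a..b, (F (s / lam) x - F (s / lam) y)) - (b - a) • (Fhat x - Fhat y) := by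
        rw [intervalIntegral.integral_sub (hFi _ _ _ _) (hFi _ _ _ _), smul_sub]; abel
      have h1 : ‖∫ s in a..b, (F (s / lam) x - F (s / lam) y)‖ ≤ L * ‖x - y‖ * |b - a| :=
        intervalIntegral.norm_integral_le_of_norm_le_const (fun s _ => hLip _ _ _ hx hy)
      rw [abs_of_nonneg h0] at h1
      have h2 : ‖(b - a) • (Fhat x - Fhat y)‖ ≤ (b - a) * (L * ‖x - y‖) := by
        rw [norm_smul, Real.norm_of_nonneg h0]
        gcongr; exact hLip' _ _ hx hy
      rw [e]
      refine (norm_sub_le _ _).trans ?_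
      have h3 : L * ‖x - y‖ * (b - a) ≤ L * ‖x - y‖ * T := by gcongr; linarith
      nlinarith) (fun x _ ε hε => av_avg F c hc hgr Fhat hgr' x (hA4 x) T hT ε hε)
  have huc := isCompact_Icc.uniformContinuousOn_of_continuous (s := Icc (0:ℝ) T) hw.continuousOn
  rw [Metric.uniformContinuousOn_iff] at huc
  obtain ⟨δ, hδ, huc⟩ := huc (ε / (4 * L * T)) (by positivity)
  obtain ⟨m, hm⟩ := exists_nat_gt (T / δ)
  have hm0 : (0:ℝ) < m := lt_trans (by positivity) hm
  have hmN : 0 < m := by exact_mod_cast hm0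
  have hmd : T / m < δ := by
    rw [div_lt_iff₀ hδ] at hm; rw [div_lt_iff₀ hm0]; linarith
  filter_upwards [huni (ε / (2 * m)) (by positivity)] with lam hlam t ht
  have := av_part (fun s => F (s / lam) (w s) - Fhat (w s)) ((hFw lam).sub hFhw) T t ht m hmN
    (ε / (2 * T)) (ε / (2 * m)) (by positivity) (by
      intro a b ha hab hb hba
      have haT : a ∈ Icc 0 T := ⟨ha, by linarith [ht.2]⟩
      have e : (∫ s in a..b, (F (s / lam) (w s) - Fhat (w s))) =
          (∫ s in a..b, ((F (s / lam) (w s) - F (s / lam) (w a)) - (Fhat (w s) - Fhat (w a)))) +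
          ((∫ s in a..b, F (s / lam) (w a)) - (b - a) • Fhat (w a)) := by
        rw [← intervalIntegral.integral_const, ← intervalIntegral.integral_sub (hFi _ _ _ _)
          (by simp), ← intervalIntegral.integral_add]
        · congr 1; ext s; abel
        · refine IntervalIntegrable.sub (IntervalIntegrable.sub ((hFw lam).intervalIntegrable _ _)
            (hFi _ _ _ _)) ((hFhw.sub continuous_const).intervalIntegrable _ _)
        · exact (hFi _ _ _ _).sub (by simp)
      rw [e]
      refine (norm_add_le _ _).trans (add_le_add ?_ ?_)
      · have h0 : 0 ≤ b - a := by linarith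
        conv_rhs => rw [← abs_of_nonneg h0]
        apply intervalIntegral.norm_integral_le_of_norm_le_const
        intro s hs
        rw [uIoc_of_le hab] at hs
        have hsT : s ∈ Icc 0 T := ⟨by linarith [hs.1], by linarith [hs.2, ht.2]⟩
        have h1 := huc s hsT a haT (by
          rw [Real.dist_eq, abs_of_nonneg (by linarith [hs.1])]; linarith [hs.2])
        rw [dist_eq_norm] at h1
        have h2 := hLip (s / lam) _ _ (hwC s hsT) (hwC a haT)
        have h3 := hLip' _ _ (hwC s hsT) (hwC a haT)
        have h4 : L * ‖w s - w a‖ ≤ L * (ε / (4 * L * T)) := by gcongr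
        have h5 : L * (ε / (4 * L * T)) = ε / (4 * T) := by field_simp
        have h6 : ε / (2 * T) = ε / (4 * T) + ε / (4 * T) := by field_simp; norm_num
        rw [h6]
        exact (norm_sub_le _ _).trans (by linarith)
      · exact hlam (a, b) ⟨ha, hab, hb.trans ht.2⟩ _ ⟨a, haT, rfl⟩)
  refine this.trans (le_of_eq ?_)
  field_simp; norm_num

lemma av_key {E : Type*} [NormedAddCommGroup E] [NormedSpace ℝ E] [CompleteSpace E]
    (R : ℝ → ℝ → ℝ → E →L[ℝ] E)
    (hRc : ∀ lam > 0, Continuous fun p : (ℝ × ℝ) × E => R lam p.1.1 p.1.2 p.2)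
    (S : ℝ → E →L[ℝ] E) (hSc : Continuous fun p : ℝ × E => S p.1 p.2)
    (T : ℝ) (hT : 0 < T) (K : ℝ) (hK : 0 < K)
    (hRK : ∀ lam > 0, ∀ t s, 0 ≤ s → s ≤ t → t ≤ T → ‖R lam t s‖ ≤ K)
    (hSK : ∀ t ∈ Icc (0:ℝ) T, ‖S t‖ ≤ K)
    (hRS : ∀ x, ∀ ε > (0:ℝ), ∀ᶠ lam in 𝓝[>] (0:ℝ), ∀ t s, 0 ≤ s → s ≤ t → t ≤ T →
      ‖R lam t s x - S (t - s) x‖ ≤ ε)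
    (F : ℝ → E → E) (hFc : Continuous fun p : ℝ × E => F p.1 p.2) (c : ℝ) (hc : 0 < c)
    (hFtb : ∀ v, TotallyBounded (range (fun t => F t v)))
    (hgr : ∀ t v, ‖F t v‖ ≤ c * (1 + ‖v‖)) (Fhat : E → E) (hFhc : Continuous Fhat)
    (hgr' : ∀ v, ‖Fhat v‖ ≤ c * (1 + ‖v‖))
    (hA4 : ∀ v, ∀ ε > (0:ℝ), ∃ T₀ > (0:ℝ), ∀ T : ℝ, T₀ ≤ T → ∀ h : ℝ, 0 ≤ h →
        ‖(1 / T) • (∫ τ in (0:ℝ)..T, F (τ + h) v) - Fhat v‖ ≤ ε)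
    (C L : ℝ) (hL : 0 < L)
    (hLip : ∀ t x y, ‖x‖ ≤ C → ‖y‖ ≤ C → ‖F t x - F t y‖ ≤ L * ‖x - y‖)
    (hLip' : ∀ x y, ‖x‖ ≤ C → ‖y‖ ≤ C → ‖Fhat x - Fhat y‖ ≤ L * ‖x - y‖)
    (w : ℝ → E) (hw : Continuous w) (hwC : ∀ t ∈ Icc (0:ℝ) T, ‖w t‖ ≤ C)
    (ε : ℝ) (hε : 0 < ε) :
    ∀ᶠ lam in 𝓝[>] (0:ℝ), ∀ t ∈ Icc (0:ℝ) T,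
      ‖(∫ s in (0:ℝ)..t, R lam t s (F (s / lam) (w s))) -
        ∫ s in (0:ℝ)..t, S (t - s) (Fhat (w s))‖ ≤ ε := by
  have hFw : ∀ (lam : ℝ), Continuous (fun s => F (s / lam) (w s)) := by
    intro lam
    exact hFc.comp ((continuous_id.div_const lam).prodMk hw)
  have hFhw : Continuous (fun s => Fhat (w s)) := hFhc.comp hw
  have hVtb : TotallyBounded (w '' Icc 0 T) := (isCompact_Icc.image hw).totallyBounded
  have hVC : ∀ v ∈ w '' Icc 0 T, ‖v‖ ≤ C := by rintro _ ⟨t, ht, rfl⟩; exact hwC t ht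
  have hpos : ∀ᶠ lam in 𝓝[>] (0:ℝ), 0 < lam := eventually_mem_nhdsWithin
  -- replacing `R` by `S`
  have h1 := av_opunif (𝓝[>] (0:ℝ)) (fun _ (k : ℝ × ℝ) => 0 ≤ k.2 ∧ k.2 ≤ k.1 ∧ k.1 ≤ T)
    (fun lam k => R lam k.1 k.2 - S (k.1 - k.2)) (2 * K) (by positivity) (by
      filter_upwards [hpos] with lam hl
      rintro ⟨t, s⟩ ⟨h0, h1, h2⟩
      refine (norm_sub_le _ _).trans ?_
      have := hRK lam hl t s h0 h1 h2
      have := hSK (t - s) ⟨sub_nonneg.2 h1, by simp only at h0 h2; linarith⟩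
      simp only
      linarith) (by
      intro x ε hε
      filter_upwards [hRS x ε hε] with lam hl
      rintro ⟨t, s⟩ ⟨h0, h1, h2⟩
      exact hl t s h0 h1 h2) F hFtb C L hL.le hLip _ hVtb hVC (ε / (2 * T)) (by positivity)
  -- equicontinuity of `S`
  have hS1 : ∀ᶠ d in 𝓝[>] (0:ℝ), ∀ k : ℝ × ℝ,
      (k.1 ∈ Icc 0 T ∧ k.2 ∈ Icc 0 T ∧ |k.1 - k.2| ≤ d) → ‖S k.1 - S k.2‖ ≤ 2 * K := by
    refine Eventually.of_forall ?_
    rintro d ⟨t, t'⟩ ⟨h1, h2, h3⟩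
    refine (norm_sub_le _ _).trans ?_
    have := hSK _ h1
    have := hSK _ h2
    linarith
  have hS2 : ∀ x : E, ∀ ε > (0:ℝ), ∀ᶠ d in 𝓝[>] (0:ℝ), ∀ k : ℝ × ℝ,
      (k.1 ∈ Icc 0 T ∧ k.2 ∈ Icc 0 T ∧ |k.1 - k.2| ≤ d) → ‖(S k.1 - S k.2) x‖ ≤ ε := by
    intro x ε hε
    have hc : Continuous (fun t => S t x) := hSc.comp (continuous_id.prodMk continuous_const)
    have huc := isCompact_Icc.uniformContinuousOn_of_continuous (s := Icc (0:ℝ) T) hc.continuousOn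
    rw [Metric.uniformContinuousOn_iff] at huc
    obtain ⟨δ, hδ, huc⟩ := huc ε hε
    have hev : ∀ᶠ d in 𝓝[>] (0:ℝ), d ∈ Ioo 0 δ := Ioo_mem_nhdsGT hδ
    filter_upwards [hev] with d hd
    rintro ⟨t, t'⟩ ⟨h1, h2, h3⟩
    have := huc t h1 t' h2 (by rw [Real.dist_eq]; exact h3.trans_lt hd.2)
    rw [dist_eq_norm] at this
    exact this.le
  have h2 := av_opunif (𝓝[>] (0:ℝ))
    (fun d (k : ℝ × ℝ) => k.1 ∈ Icc 0 T ∧ k.2 ∈ Icc 0 T ∧ |k.1 - k.2| ≤ d)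
    (fun d k => S k.1 - S k.2) (2 * K) (by positivity) hS1 hS2
    F hFtb C L hL.le hLip _ hVtb hVC (ε / (8 * T)) (by positivity)
  have h3 := av_opunif (𝓝[>] (0:ℝ))
    (fun d (k : ℝ × ℝ) => k.1 ∈ Icc 0 T ∧ k.2 ∈ Icc 0 T ∧ |k.1 - k.2| ≤ d)
    (fun d k => S k.1 - S k.2) (2 * K) (by positivity) hS1 hS2
    (fun _ => Fhat) (fun v => by
      rw [range_const]; exact isCompact_singleton.totallyBounded)
    C L hL.le (fun _ => hLip') _ hVtb hVC (ε / (8 * T)) (by positivity)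
  obtain ⟨d, hd2, hd3, hd⟩ := (h2.and (h3.and (eventually_mem_nhdsWithin (a := (0:ℝ))))).exists
  have hd0 : 0 < d := hd
  obtain ⟨m, hm⟩ := exists_nat_gt (T / d)
  have hm0 : (0:ℝ) < m := lt_trans (by positivity) hm
  have hmN : 0 < m := by exact_mod_cast hm0
  have hmd : T / m < d := by
    rw [div_lt_iff₀ hd0] at hm; rw [div_lt_iff₀ hm0]; linarith
  have hW := av_W F hFc c hc hgr Fhat hFhc hgr' hA4 T hT C L hL hLip hLip' w hw hwC
    (ε / (8 * K * m)) (by positivity)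
  filter_upwards [h1, hW, hpos] with lam h1 hW hl t ht
  have hg : Continuous (fun s => F (s / lam) (w s) - Fhat (w s)) := (hFw lam).sub hFhw
  have hSi : ∀ z : ℝ → E, Continuous z → Continuous (fun s => S (t - s) (z s)) := by
    intro z hz
    exact hSc.comp ((continuous_const.sub continuous_id).prodMk hz)
  have hRi : Continuous (fun s => R lam t s (F (s / lam) (w s))) :=
    (hRc lam hl).comp ((continuous_const.prodMk continuous_id).prodMk (hFw lam))
  have e : (∫ s in (0:ℝ)..t, R lam t s (F (s / lam) (w s))) -
        ∫ s in (0:ℝ)..t, S (t - s) (Fhat (w s)) =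
      (∫ s in (0:ℝ)..t, (R lam t s - S (t - s)) (F (s / lam) (w s))) +
      ∫ s in (0:ℝ)..t, S (t - s) (F (s / lam) (w s) - Fhat (w s)) := by
    rw [← intervalIntegral.integral_sub (hRi.intervalIntegrable _ _)
      ((hSi _ hFhw).intervalIntegrable _ _), ← intervalIntegral.integral_add]
    · congr 1; ext s; simp
    · exact (hRi.sub (hSi _ (hFw lam))).intervalIntegrable _ _
    · exact (hSi _ hg).intervalIntegrable _ _
  rw [e]
  have b1 : ‖∫ s in (0:ℝ)..t, (R lam t s - S (t - s)) (F (s / lam) (w s))‖ ≤ ε / 2 := by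
    have : ‖∫ s in (0:ℝ)..t, (R lam t s - S (t - s)) (F (s / lam) (w s))‖ ≤
        ε / (2 * T) * |t - 0| := by
      apply intervalIntegral.norm_integral_le_of_norm_le_const
      intro s hs
      rw [uIoc_of_le ht.1] at hs
      exact h1 (t, s) ⟨hs.1.le, hs.2, ht.2⟩ _ _ ⟨s, ⟨hs.1.le, hs.2.trans ht.2⟩, rfl⟩
    rw [sub_zero, abs_of_nonneg ht.1] at this
    calc _ ≤ _ := this
      _ ≤ ε / (2 * T) * T := by gcongr; exact ht.2
      _ = ε / 2 := by field_simp
  have b2 := av_part (fun s => S (t - s) (F (s / lam) (w s) - Fhat (w s))) (hSi _ hg) T t ht m hmN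
    (ε / (4 * T)) (K * (2 * (ε / (8 * K * m)))) (by positivity) (by
      intro a b ha hab hb hba
      have e : (∫ s in a..b, S (t - s) (F (s / lam) (w s) - Fhat (w s))) =
        (∫ s in a..b, (S (t - s) - S (t - a)) (F (s / lam) (w s) - Fhat (w s))) +
          S (t - a) ((∫ s in (0:ℝ)..b, (F (s / lam) (w s) - Fhat (w s))) -
            ∫ s in (0:ℝ)..a, (F (s / lam) (w s) - Fhat (w s))) := by
        rw [intervalIntegral.integral_interval_sub_left (hg.intervalIntegrable _ _)
          (hg.intervalIntegrable _ _), ← ContinuousLinearMap.intervalIntegral_comp_comm _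
          (hg.intervalIntegrable _ _), ← intervalIntegral.integral_add]
        · congr 1; ext s; simp
        · exact ((hSi _ hg).sub ((S (t - a)).continuous.comp hg)).intervalIntegrable _ _
        · exact ((S (t - a)).continuous.comp hg).intervalIntegrable _ _
      rw [e]
      refine (norm_add_le _ _).trans (add_le_add ?_ ?_)
      · have h0 : 0 ≤ b - a := by linarith
        conv_rhs => rw [← abs_of_nonneg h0]
        apply intervalIntegral.norm_integral_le_of_norm_le_const
        intro s hs
        rw [uIoc_of_le hab] at hs
        have hk : (t - s) ∈ Icc 0 T ∧ (t - a) ∈ Icc 0 T ∧ |(t - s) - (t - a)| ≤ d := by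
          have := ht.2
          refine ⟨⟨by linarith [hs.2], by linarith [hs.1]⟩, ⟨by linarith, by linarith⟩, ?_⟩
          rw [abs_le]
          exact ⟨by linarith [hs.2], by linarith [hs.1]⟩
        have hsV : w s ∈ w '' Icc 0 T := ⟨s, ⟨by linarith [hs.1], by linarith [hs.2, ht.2]⟩, rfl⟩
        have i1 := hd2 (t - s, t - a) hk (s / lam) _ hsV
        have i2 := hd3 (t - s, t - a) hk 0 _ hsV
        rw [map_sub]
        have h6 : ε / (4 * T) = ε / (8 * T) + ε / (8 * T) := by field_simp; norm_num
        rw [h6]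
        exact (norm_sub_le _ _).trans (add_le_add i1 i2)
      · refine ((S (t - a)).le_opNorm _).trans ?_
        have hT2 := ht.2
        refine mul_le_mul (hSK _ ⟨by linarith, by linarith⟩) ?_ (norm_nonneg _) hK.le
        refine (norm_sub_le _ _).trans ?_
        have j1 := hW b ⟨by linarith, by linarith⟩
        have j2 := hW a ⟨by linarith, by linarith⟩
        linarith)
  have b3 : ε / (4 * T) * T + m * (K * (2 * (ε / (8 * K * m)))) = ε / 2 := by
    field_simp; norm_num
  rw [b3] at b2
  refine (norm_add_le _ _).trans ?_
  linarith

/-- Averaging principle for `u̇ = A(t/λ)u + F(t/λ, u)`: mild solutions converge, uniformly on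
bounded intervals, to the mild solution of the averaged autonomous problem. -/
theorem averaging_principle
    {E : Type*} [NormedAddCommGroup E] [NormedSpace ℝ E] [CompleteSpace E]
    [TopologicalSpace.SeparableSpace E]
    (R : ℝ → ℝ → ℝ → E →L[ℝ] E)
    (hR : ∀ lam : ℝ, 0 < lam → IsEvolutionSystem (R lam))
    -- (A1)
    (M ω : ℝ) (hM : 1 ≤ M)
    (hA1 : ∀ lam : ℝ, 0 < lam → ∀ t s : ℝ, 0 ≤ s → s ≤ t →
      ‖R lam t s‖ ≤ M * Real.exp (ω * (t - s)))
    -- (A2)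
    (S : ℝ → E →L[ℝ] E) (hS : IsC0Semigroup S)
    (hA2 : ∀ u : E, ∀ T : ℝ, 0 < T → ∀ ε > (0:ℝ), ∃ δ > (0:ℝ),
      ∀ lam : ℝ, 0 < lam → lam < δ → ∀ v : E, ‖v - u‖ < δ →
        ∀ t s : ℝ, 0 ≤ s → s ≤ t → t ≤ T → ‖R lam t s v - S (t - s) u‖ ≤ ε)
    -- (A3)
    (F : ℝ → E → E)
    (hFcont : ContinuousOn (fun p : ℝ × E => F p.1 p.2) (Set.Ici 0 ×ˢ Set.univ))
    (hFlip : ∀ C : ℝ, 0 < C → ∃ L > (0:ℝ), ∀ t : ℝ, 0 ≤ t → ∀ v₁ v₂ : E,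
      ‖v₁‖ ≤ C → ‖v₂‖ ≤ C → ‖F t v₁ - F t v₂‖ ≤ L * ‖v₁ - v₂‖)
    (c : ℝ) (hc : 0 < c)
    (hFgrowth : ∀ t : ℝ, 0 ≤ t → ∀ v : E, ‖F t v‖ ≤ c * (1 + ‖v‖))
    -- (A4)
    (hFcomp : ∀ u : E, IsCompact (closure {y : E | ∃ t : ℝ, 0 ≤ t ∧ y = F t u}))
    (Fhat : E → E) (hFhatLip : LocallyLipschitz Fhat)
    (hA4 : ∀ u : E, ∀ ε > (0:ℝ), ∃ T₀ > (0:ℝ), ∃ δ > (0:ℝ), ∀ T : ℝ, T₀ ≤ T →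
      ∀ v : E, ‖v - u‖ < δ → ∀ h : ℝ, 0 < h →
        ‖(1 / T) • (∫ τ in (0:ℝ)..T, F (τ + h) v) - Fhat u‖ ≤ ε)
    -- the sequences of parameters, initial data and mild solutions
    (lam : ℕ → ℝ) (hlam : ∀ n, 0 < lam n) (hlam0 : Tendsto lam atTop (𝓝 0))
    (u₀ : E) (uinit : ℕ → E) (huinit : Tendsto uinit atTop (𝓝 u₀))
    (u : ℕ → ℝ → E)
    (hucont : ∀ n, ContinuousOn (u n) (Set.Ici 0))
    (hu : ∀ n, ∀ t : ℝ, 0 ≤ t → u n t = R (lam n) t 0 (uinit n) +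
      ∫ s in (0:ℝ)..t, R (lam n) t s (F (s / lam n) (u n s))) :
    ∃ uhat : ℝ → E,
      (ContinuousOn uhat (Set.Ici 0) ∧
        ∀ t : ℝ, 0 ≤ t → uhat t = S t u₀ + ∫ s in (0:ℝ)..t, S (t - s) (Fhat (uhat s))) ∧
      (∀ v : ℝ → E, ContinuousOn v (Set.Ici 0) →
        (∀ t : ℝ, 0 ≤ t → v t = S t u₀ + ∫ s in (0:ℝ)..t, S (t - s) (Fhat (v s))) →
        ∀ t : ℝ, 0 ≤ t → v t = uhat t) ∧
      (∀ T : ℝ, 0 < T → ∀ ε > (0:ℝ), ∃ N : ℕ, ∀ n ≥ N, ∀ t ∈ Set.Icc (0:ℝ) T,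
        ‖u n t - uhat t‖ ≤ ε) := by
  have hM0 : 0 ≤ M := by linarith
  -- bounds for `S`
  have hSb : ∀ t ≥ 0, ‖S t‖ ≤ M * Real.exp (ω * t) := by
    intro t ht
    refine ContinuousLinearMap.opNorm_le_bound _ (by positivity) fun x => ?_
    refine le_of_forall_pos_le_add fun ε hε => ?_
    obtain ⟨δ, hδ, h⟩ := hA2 x (t + 1) (by linarith) ε hε
    have h1 := h (δ / 2) (by positivity) (by linarith) x (by simpa using hδ) t 0 le_rfl ht
      (by linarith)
    have h2 := hA1 (δ / 2) (by positivity) t 0 le_rfl ht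
    rw [sub_zero] at h1 h2
    have h3 : ‖R (δ / 2) t 0 x‖ ≤ M * Real.exp (ω * t) * ‖x‖ :=
      ((R (δ / 2) t 0).le_opNorm _).trans (by gcongr)
    have h4 : ‖S t x‖ ≤ ‖R (δ / 2) t 0 x‖ + ‖R (δ / 2) t 0 x - S t x‖ := by
      simpa using norm_sub_le (R (δ / 2) t 0 x) (R (δ / 2) t 0 x - S t x)
    linarith
  have hm : Continuous (fun t : ℝ => max t 0) := by fun_prop
  -- globalized objects
  obtain ⟨F', hF'⟩ : ∃ F' : ℝ → E → E, F' = fun t v => F (max t 0) v := ⟨_, rfl⟩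
  obtain ⟨S', hS'⟩ : ∃ S' : ℝ → E →L[ℝ] E, S' = fun t => S (max t 0) := ⟨_, rfl⟩
  obtain ⟨R', hR'⟩ : ∃ R' : ℝ → ℝ → ℝ → E →L[ℝ] E,
    R' = fun lam t s => R lam (max t (max s 0)) (max s 0) := ⟨_, rfl⟩
  have F'eq : ∀ t ≥ 0, F' t = F t := by
    intro t ht; rw [hF']; ext v; simp only [max_eq_left ht]
  have S'eq : ∀ t ≥ 0, S' t = S t := by
    intro t ht; rw [hS']; simp only [max_eq_left ht]
  have R'eq : ∀ lam t s, 0 ≤ s → s ≤ t → R' lam t s = R lam t s := by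
    intro lam t s hs hst; rw [hR']; simp only [max_eq_left hs, max_eq_left hst]
  have F'c : Continuous fun p : ℝ × E => F' p.1 p.2 := by
    rw [hF']
    exact hFcont.comp_continuous (f := fun p : ℝ × E => (max p.1 0, p.2)) (by fun_prop)
      (fun p => ⟨mem_Ici.2 (le_max_right _ _), mem_univ _⟩)
  have S'c : Continuous fun p : ℝ × E => S' p.1 p.2 := by
    apply av_jointcont S' _ (fun t => M * Real.exp (ω * max t 0)) (by fun_prop)
    · intro t; rw [hS']; exact hSb _ (le_max_right _ _)
    · intro x; rw [hS']
      exact (hS.2.2 x).comp_continuous hm (fun t => mem_Ici.2 (le_max_right _ _))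
  have R'c : ∀ lam > 0, Continuous fun p : (ℝ × ℝ) × E => R' lam p.1.1 p.1.2 p.2 := by
    intro lam hl
    apply av_jointcont (fun p : ℝ × ℝ => R' lam p.1 p.2) _
      (fun p => M * Real.exp (ω * (max p.1 (max p.2 0) - max p.2 0))) (by fun_prop)
    · intro p; rw [hR']; exact hA1 lam hl _ _ (le_max_right _ _) (le_max_right _ _)
    · intro x; rw [hR']
      exact ((hR lam hl).2.2 x).comp_continuous
        (f := fun p : ℝ × ℝ => (max p.1 (max p.2 0), max p.2 0)) (by fun_prop)
        (fun p => ⟨le_max_right _ _, le_max_right _ _⟩)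
  have F'gr : ∀ t v, ‖F' t v‖ ≤ c * (1 + ‖v‖) := by
    intro t v; rw [hF']; exact hFgrowth _ (le_max_right _ _) v
  have F'lip : ∀ C : ℝ, 0 < C → ∃ L > (0:ℝ), ∀ t v₁ v₂,
      ‖v₁‖ ≤ C → ‖v₂‖ ≤ C → ‖F' t v₁ - F' t v₂‖ ≤ L * ‖v₁ - v₂‖ := by
    intro C hC
    obtain ⟨L, hL, h⟩ := hFlip C hC
    exact ⟨L, hL, fun t => by rw [hF']; exact h _ (le_max_right _ _)⟩
  have F'tb : ∀ v, TotallyBounded (range fun t => F' t v) := by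
    intro v
    refine (hFcomp v).totallyBounded.subset ?_
    rintro _ ⟨t, rfl⟩
    exact subset_closure ⟨max t 0, le_max_right _ _, by rw [hF']⟩
  have F'A4 : ∀ v, ∀ ε > (0:ℝ), ∃ T₀ > (0:ℝ), ∀ T : ℝ, T₀ ≤ T → ∀ h : ℝ, 0 ≤ h →
      ‖(1 / T) • (∫ τ in (0:ℝ)..T, F' (τ + h) v) - Fhat v‖ ≤ ε := by
    intro v ε hε
    obtain ⟨T₀, hT₀, δ, hδ, h⟩ := hA4 v ε hε
    refine ⟨T₀, hT₀, fun T hT k hk => ?_⟩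
    have hc1 : Continuous (fun k : ℝ => ‖(1 / T) • (∫ τ in (0:ℝ)..T, F' (τ + k) v) - Fhat v‖) := by
      have : Continuous (fun k : ℝ => ∫ τ in (0:ℝ)..T, F' (τ + k) v) :=
        intervalIntegral.continuous_parametric_intervalIntegral_of_continuous
          (f := fun k τ => F' (τ + k) v)
          (F'c.comp ((continuous_snd.add continuous_fst).prodMk continuous_const)) continuous_const
      fun_prop
    refine le_of_tendsto (hc1.continuousWithinAt (s := Ioi k) (x := k)) ?_
    filter_upwards [self_mem_nhdsWithin] with k' hk'
    have hk0 : 0 < k' := lt_of_le_of_lt hk hk'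
    have h1 := h T hT v (by simpa using hδ) k' hk0
    have h2 : (∫ τ in (0:ℝ)..T, F' (τ + k') v) = ∫ τ in (0:ℝ)..T, F (τ + k') v := by
      apply intervalIntegral.integral_congr
      intro s hs
      rw [uIcc_of_le (by linarith)] at hs
      simp only
      rw [F'eq _ (by linarith [hs.1])]
    rw [h2]; exact h1
  have Fhc : Continuous Fhat := hFhatLip.continuous
  have Fhgr : ∀ v, ‖Fhat v‖ ≤ c * (1 + ‖v‖) := by
    intro v
    refine le_of_forall_pos_le_add fun ε hε => ?_
    obtain ⟨T₀, hT₀, h⟩ := F'A4 v ε hε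
    have h1 := h T₀ le_rfl 0 le_rfl
    have h2 : ‖∫ τ in (0:ℝ)..T₀, F' (τ + 0) v‖ ≤ c * (1 + ‖v‖) * |T₀ - 0| :=
      intervalIntegral.norm_integral_le_of_norm_le_const (fun s _ => F'gr _ _)
    rw [sub_zero, abs_of_pos hT₀] at h2
    have h3 : ‖(1 / T₀) • ∫ τ in (0:ℝ)..T₀, F' (τ + 0) v‖ ≤ c * (1 + ‖v‖) := by
      rw [norm_smul, Real.norm_of_nonneg (by positivity), one_div_mul_eq_div, div_le_iff₀ hT₀]
      exact h2
    have h4 := norm_sub_le ((1 / T₀) • ∫ τ in (0:ℝ)..T₀, F' (τ + 0) v)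
      ((1 / T₀) • (∫ τ in (0:ℝ)..T₀, F' (τ + 0) v) - Fhat v)
    rw [sub_sub_cancel] at h4
    linarith
  have Fhlip' : ∀ C L : ℝ, (∀ t v₁ v₂,
      ‖v₁‖ ≤ C → ‖v₂‖ ≤ C → ‖F' t v₁ - F' t v₂‖ ≤ L * ‖v₁ - v₂‖) →
      ∀ x y, ‖x‖ ≤ C → ‖y‖ ≤ C → ‖Fhat x - Fhat y‖ ≤ L * ‖x - y‖ := by
    intro C L hL x y hx hy
    refine le_of_forall_pos_le_add fun ε hε => ?_
    obtain ⟨T₁, hT₁, h1⟩ := F'A4 x (ε / 2) (by positivity)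
    obtain ⟨T₂, hT₂, h2⟩ := F'A4 y (ε / 2) (by positivity)
    obtain ⟨T₀, hT₀⟩ : ∃ T₀, T₀ = max T₁ T₂ := ⟨_, rfl⟩
    have hT0 : 0 < T₀ := by rw [hT₀]; positivity
    have g1 := h1 T₀ (by rw [hT₀]; exact le_max_left _ _) 0 le_rfl
    have g2 := h2 T₀ (by rw [hT₀]; exact le_max_right _ _) 0 le_rfl
    have hi : ∀ v : E, IntervalIntegrable (fun τ => F' (τ + 0) v) volume 0 T₀ := fun v =>
      (F'c.comp ((continuous_id.add continuous_const).prodMk continuous_const)).intervalIntegrable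
        _ _
    have g3 : ‖∫ τ in (0:ℝ)..T₀, (F' (τ + 0) x - F' (τ + 0) y)‖ ≤ L * ‖x - y‖ * |T₀ - 0| :=
      intervalIntegral.norm_integral_le_of_norm_le_const (fun s _ => hL _ _ _ hx hy)
    rw [sub_zero, abs_of_pos hT0, intervalIntegral.integral_sub (hi x) (hi y)] at g3
    have g4 : ‖(1 / T₀) • ((∫ τ in (0:ℝ)..T₀, F' (τ + 0) x) - ∫ τ in (0:ℝ)..T₀, F' (τ + 0) y)‖ ≤
        L * ‖x - y‖ := by
      rw [norm_smul, Real.norm_of_nonneg (by positivity), one_div_mul_eq_div, div_le_iff₀ hT0]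
      exact g3
    rw [smul_sub] at g4
    generalize (1 / T₀) • (∫ τ in (0:ℝ)..T₀, F' (τ + 0) x) = a at g1 g4
    generalize (1 / T₀) • (∫ τ in (0:ℝ)..T₀, F' (τ + 0) y) = b at g2 g4
    have e : Fhat x - Fhat y = (a - b) - (a - Fhat x) + (b - Fhat y) := by abel
    rw [e]
    refine (norm_add_le _ _).trans ?_
    have := norm_sub_le (a - b) (a - Fhat x)
    linarith
  have Fhlip : ∀ C > (0:ℝ), ∃ L > (0:ℝ), ∀ x y, ‖x‖ ≤ C → ‖y‖ ≤ C →
      ‖Fhat x - Fhat y‖ ≤ L * ‖x - y‖ := by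
    intro C hC
    obtain ⟨L, hL, h⟩ := F'lip C hC
    exact ⟨L, hL, Fhlip' C L h⟩
  have hωabs : ∀ T t : ℝ, 0 ≤ t → t ≤ T → M * Real.exp (ω * t) ≤ M * Real.exp (|ω| * T) := by
    intro T t h0 h1
    gcongr
    exact le_abs_self ω
  have S'K : ∀ T : ℝ, ∀ t ∈ Icc (0:ℝ) T, ‖S' t‖ ≤ M * Real.exp (|ω| * T) := by
    intro T t ht
    rw [S'eq t ht.1]
    exact (hSb t ht.1).trans (hωabs T t ht.1 ht.2)
  have S'int : ∀ (t : ℝ), 0 ≤ t → ∀ z : ℝ → E,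
      (∫ s in (0:ℝ)..t, S' (t - s) (Fhat (z s))) = ∫ s in (0:ℝ)..t, S (t - s) (Fhat (z s)) := by
    intro t ht z
    apply intervalIntegral.integral_congr
    intro s hs
    rw [uIcc_of_le ht] at hs
    simp only
    rw [S'eq _ (by linarith [hs.2])]
  obtain ⟨w, hwc, hw⟩ := av_exist S' S'c M |ω| hM0 (abs_nonneg _)
    (fun t ht => S'K t t ⟨ht, le_rfl⟩) Fhat Fhc Fhlip c hc Fhgr u₀
  refine ⟨w, ⟨hwc.continuousOn, fun t ht => ?_⟩, ?_, ?_⟩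
  · rw [← S'int t ht w, ← S'eq t ht]; exact hw t ht
  · intro v hv hv1 t ht
    have hv' : Continuous (fun t => v (max t 0)) :=
      hv.comp_continuous hm (fun t => mem_Ici.2 (le_max_right _ _))
    have := av_uniq S' S'c _ t (by positivity) (S'K t) Fhat Fhc Fhlip u₀
      (fun t => v (max t 0)) w hv' hwc (by
        intro t ht
        rw [max_eq_left ht.1, hv1 t ht.1, S'int t ht.1 (fun s => v (max s 0)), S'eq t ht.1]
        congr 1
        apply intervalIntegral.integral_congr
        intro s hs
        rw [uIcc_of_le ht.1] at hs
        simp only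
        rw [max_eq_left hs.1]) (fun t ht => hw t ht.1) t ⟨ht, le_rfl⟩
    simp only [max_eq_left ht] at this
    exact this
  · intro T hT ε hε
    obtain ⟨K, hK⟩ : ∃ K, K = M * Real.exp (|ω| * T) := ⟨_, rfl⟩
    have hK0 : 0 < K := by rw [hK]; positivity
    have hSK : ∀ t ∈ Icc (0:ℝ) T, ‖S' t‖ ≤ K := by rw [hK]; exact S'K T
    have hRK : ∀ lam > 0, ∀ t s, 0 ≤ s → s ≤ t → t ≤ T → ‖R' lam t s‖ ≤ K := by
      intro lam hl t s h0 h1 h2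
      rw [R'eq lam t s h0 h1, hK]
      exact (hA1 lam hl t s h0 h1).trans (hωabs T (t - s) (by linarith) (by linarith))
    have u'c : ∀ n, Continuous (fun t => u n (max t 0)) := fun n =>
      (hucont n).comp_continuous hm (fun t => mem_Ici.2 (le_max_right _ _))
    have u'eq : ∀ n, ∀ t ≥ 0, u n (max t 0) = R' (lam n) t 0 (uinit n) +
        ∫ s in (0:ℝ)..t, R' (lam n) t s (F' (s / lam n) (u n (max s 0))) := by
      intro n t ht
      rw [max_eq_left ht, hu n t ht, R'eq _ _ _ le_rfl ht]
      congr 1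
      apply intervalIntegral.integral_congr
      intro s hs
      rw [uIcc_of_le ht] at hs
      simp only
      rw [max_eq_left hs.1, R'eq _ _ _ hs.1 hs.2, F'eq _ (div_nonneg hs.1 (hlam n).le)]
    -- a priori bound
    obtain ⟨C₁, hC₁⟩ : ∃ C₁, C₁ = (K * (‖u₀‖ + 1) + K * c * T) * Real.exp (K * c * T) := ⟨_, rfl⟩
    have hub : ∀ n, ‖uinit n‖ ≤ ‖u₀‖ + 1 → ∀ t ∈ Icc (0:ℝ) T, ‖u n (max t 0)‖ ≤ C₁ := by
      intro n hn
      have := av_gronwall (fun t => ‖u n (max t 0)‖) (u'c n).norm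
        (K * (‖u₀‖ + 1) + K * c * T) (K * c) T (by positivity) (by
          intro t ht
          conv_lhs => rw [u'eq n t ht.1]
          refine (norm_add_le _ _).trans ?_
          have h1 : ‖R' (lam n) t 0 (uinit n)‖ ≤ K * (‖u₀‖ + 1) :=
            ((R' (lam n) t 0).le_opNorm _).trans
              (mul_le_mul (hRK _ (hlam n) t 0 le_rfl ht.1 ht.2) hn (norm_nonneg _) hK0.le)
          have h2 := av_int_bound (fun s => R' (lam n) t s)
            (fun s => F' (s / lam n) (u n (max s 0))) K hK0.le t ht.1
            (fun s hs => hRK _ (hlam n) t s hs.1 hs.2 ht.2) c c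
            (fun t => ‖u n (max t 0)‖) (u'c n).norm (by
              intro s hs
              refine (F'gr _ _).trans (le_of_eq ?_)
              ring)
          have h3 : K * c * t ≤ K * c * T := by
            gcongr; exact ht.2
          linarith)
      intro t ht
      refine (this t ht).trans ?_
      rw [hC₁]
      gcongr
      exact ht.2
    obtain ⟨C₂, hC₂, hwb⟩ := av_bdd w hwc T
    obtain ⟨L, hL, hLip⟩ := F'lip (max C₁ C₂) (lt_max_of_lt_right hC₂)
    obtain ⟨ε', hε'⟩ : ∃ ε', ε' = ε / (2 * Real.exp (K * L * T)) := ⟨_, rfl⟩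
    have hε'0 : 0 < ε' := by rw [hε']; positivity
    have hkey := av_key R' R'c S' S'c T hT K hK0 hRK hSK (by
      intro x ε hε
      obtain ⟨δ, hδ, h⟩ := hA2 x T hT ε hε
      have hev : ∀ᶠ d in 𝓝[>] (0:ℝ), d ∈ Ioo 0 δ := Ioo_mem_nhdsGT hδ
      filter_upwards [hev] with d hd t s h0 h1 h2
      rw [R'eq _ _ _ h0 h1, S'eq _ (by linarith)]
      exact h d hd.1 hd.2 x (by simpa using hδ) t s h0 h1 h2) F' F'c c hc F'tb F'gr Fhat Fhc Fhgr
      F'A4 (max C₁ C₂) L hL hLip (Fhlip' _ L hLip) w hwc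
      (fun t ht => (hwb t ht).trans (le_max_right _ _)) ε' hε'0
    have hlam' : Tendsto lam atTop (𝓝[>] 0) :=
      tendsto_nhdsWithin_iff.2 ⟨hlam0, Eventually.of_forall hlam⟩
    have hkey' := hlam'.eventually hkey
    obtain ⟨δ, hδ, hinit⟩ := hA2 u₀ T hT ε' hε'0
    have hev : ∀ᶠ n in atTop, lam n < δ := hlam0.eventually (eventually_lt_nhds hδ)
    have hev2 : ∀ᶠ n in atTop, ‖uinit n - u₀‖ < δ := by
      have := (Metric.tendsto_nhds.1 huinit) δ hδ
      simpa only [dist_eq_norm] using this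
    have hev3 : ∀ᶠ n in atTop, ‖uinit n - u₀‖ < 1 := by
      have := (Metric.tendsto_nhds.1 huinit) 1 one_pos
      simpa only [dist_eq_norm] using this
    obtain ⟨N, hN⟩ := eventually_atTop.1 (hkey'.and (hev.and (hev2.and hev3)))
    refine ⟨N, fun n hn => ?_⟩
    obtain ⟨k1, k2, k3, k4⟩ := hN n hn
    have hun := hub n (by
      have := norm_add_le (uinit n - u₀) u₀
      rw [sub_add_cancel] at this
      linarith)
    have := av_gronwall (fun t => ‖u n (max t 0) - w t‖) ((u'c n).sub hwc).norm
      (2 * ε') (K * L) T (by positivity) (by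
        intro t ht
        have hi : ∀ z : ℝ → E, Continuous z → IntervalIntegrable
            (fun s => R' (lam n) t s (F' (s / lam n) (z s))) volume 0 t := by
          intro z hz
          exact ((R'c _ (hlam n)).comp ((continuous_const.prodMk continuous_id).prodMk
            (F'c.comp ((continuous_id.div_const _).prodMk hz)))).intervalIntegrable _ _
        have e : u n (max t 0) - w t = (R' (lam n) t 0 (uinit n) - S' t u₀) +
            ((∫ s in (0:ℝ)..t, R' (lam n) t s (F' (s / lam n) (w s))) -
              ∫ s in (0:ℝ)..t, S' (t - s) (Fhat (w s))) +
            ∫ s in (0:ℝ)..t, R' (lam n) t s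
              (F' (s / lam n) (u n (max s 0)) - F' (s / lam n) (w s)) := by
          simp only [map_sub]
          rw [intervalIntegral.integral_sub (hi _ (u'c n)) (hi w hwc)]
          conv_lhs => rw [u'eq n t ht.1, hw t ht.1]
          abel
        have i1 : ‖R' (lam n) t 0 (uinit n) - S' t u₀‖ ≤ ε' := by
          rw [R'eq _ _ _ le_rfl ht.1, S'eq t ht.1]
          have := hinit (lam n) (hlam n) k2 (uinit n) k3 t 0 le_rfl ht.1 ht.2
          rwa [sub_zero] at this
        have i2 := k1 t ht
        have i3 := av_int_bound (fun s => R' (lam n) t s)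
          (fun s => F' (s / lam n) (u n (max s 0)) - F' (s / lam n) (w s)) K hK0.le t ht.1
          (fun s hs => hRK _ (hlam n) t s hs.1 hs.2 ht.2) 0 L
          (fun t => ‖u n (max t 0) - w t‖) ((u'c n).sub hwc).norm (by
            intro s hs
            have hs' : s ∈ Icc 0 T := ⟨hs.1, hs.2.trans ht.2⟩
            rw [zero_add]
            exact hLip _ _ _ ((hun s hs').trans (le_max_left _ _))
              ((hwb s hs').trans (le_max_right _ _)))
        conv_lhs => rw [e]
        refine (norm_add_le _ _).trans ?_
        have i4 := norm_add_le (R' (lam n) t 0 (uinit n) - S' t u₀)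
          ((∫ s in (0:ℝ)..t, R' (lam n) t s (F' (s / lam n) (w s))) -
              ∫ s in (0:ℝ)..t, S' (t - s) (Fhat (w s)))
        rw [mul_zero, zero_mul, zero_add] at i3
        linarith)
    intro t ht
    have h1 := this t ht
    simp only [max_eq_left ht.1] at h1
    refine h1.trans ?_
    calc 2 * ε' * Real.exp (K * L * t) ≤ 2 * ε' * Real.exp (K * L * T) := by
          gcongr; exact ht.2
      _ = ε := by rw [hε']; field_simp
end

section
/- (Kato) Let V be a Banach space densely and continuously embedded in a Banach space E and let {A(t)}_{t≥0} be a family of linear operators in E satisfying the hyperbolic conditions (Hyp1)–(Hyp3) with constants M, ω (stability on E) and M_V, ω_V (stability of the parts on V). Then there exists a unique evolution system {R(t,s)}_{t≥s≥0} on E such that: (i) ‖R(t,s)‖ ≤ M e^{ω(t−s)} for 0≤s≤t; (ii) the right derivative ∂⁺/∂t R(t,s)v at t=s equals A(s)v for every v∈V, s≥0; (iii) ∂/∂s R(t,s)v = −R(t,s)A(s)v for every v∈V and 0≤s≤t. -/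
open MeasureTheory Filter Set Topology

/-- The composition `S(t_{n-1})(s_{n-1}) ∘ ⋯ ∘ S(t_0)(s_0)` of members of a two-parameter
family of operators. -/
def prodOps {E : Type*} [NormedAddCommGroup E] [NormedSpace ℝ E]
    (S : ℝ → ℝ → E →L[ℝ] E) (t s : ℕ → ℝ) : ℕ → E →L[ℝ] E
  | 0 => ContinuousLinearMap.id ℝ E
  | n + 1 => (S (t n) (s n)).comp (prodOps S t s n)

/-- Stability of a family `{S(t)}_{t ≥ 0}` of semigroups with constants `M`, `ω`:
`‖S(tₙ)(sₙ) ⋯ S(t₁)(s₁)‖ ≤ M e^{ω(s₁+⋯+sₙ)}` for `0 ≤ t₁ ≤ ⋯ ≤ tₙ` and `sᵢ ≥ 0`. -/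
def IsStableFamily {E : Type*} [NormedAddCommGroup E] [NormedSpace ℝ E]
    (S : ℝ → ℝ → E →L[ℝ] E) (M ω : ℝ) : Prop :=
  ∀ (n : ℕ) (t s : ℕ → ℝ), (∀ i, 0 ≤ t i) → (∀ i j, i ≤ j → t i ≤ t j) → (∀ i, 0 ≤ s i) →
    ‖prodOps S t s n‖ ≤ M * Real.exp (ω * ∑ i ∈ Finset.range n, s i)

/-- The hyperbolic (Kato) conditions (Hyp1)–(Hyp3) for a family `{A(t)}_{t≥0}` of generators,
relative to a continuous dense embedding `ι : V → E`. Here `S t` is the `C₀` semigroup on `E`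
generated by `A(t)`, `SV t` is its restriction to `V` (admissibility), and
`A t : V →L[ℝ] E` is the restriction of `A(t)` to `V` (so that `V ⊆ D(A(t))`). -/
structure IsHyperbolicFamily {V E : Type*}
    [NormedAddCommGroup V] [NormedSpace ℝ V]
    [NormedAddCommGroup E] [NormedSpace ℝ E]
    (iota : V →L[ℝ] E) (A : ℝ → (V →L[ℝ] E))
    (S : ℝ → ℝ → E →L[ℝ] E) (SV : ℝ → ℝ → V →L[ℝ] V)
    (M om MV omV : ℝ) : Prop where
  /-- (Hyp1): each `S t` is a `C₀` semigroup on `E`. -/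
  sem_E : ∀ t : ℝ, 0 ≤ t → IsC0Semigroup (S t)
  /-- (Hyp1)/(Hyp3): `A(t)v` is the generator of `S t` applied to `v ∈ V`. -/
  gen_on_V : ∀ t : ℝ, 0 ≤ t → ∀ v : V,
    Filter.Tendsto (fun h : ℝ => h⁻¹ • (S t h (iota v) - iota v)) (nhdsWithin 0 (Set.Ioi 0))
      (nhds (A t v))
  /-- (Hyp1): stability on `E` with constants `M`, `ω`. -/
  stable_E : IsStableFamily S M om
  /-- (Hyp2): each restricted semigroup `SV t` is a `C₀` semigroup on `V`. -/
  sem_V : ∀ t : ℝ, 0 ≤ t → IsC0Semigroup (SV t)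
  /-- (Hyp2): `V` is `A(t)`-admissible, `SV t` being the restriction of `S t` to `V`. -/
  compat : ∀ t h : ℝ, 0 ≤ t → 0 ≤ h → ∀ v : V, iota (SV t h v) = S t h (iota v)
  /-- (Hyp2): stability on `V` with constants `M_V`, `ω_V`. -/
  stable_V : IsStableFamily SV MV omV
  /-- (Hyp3): `t ↦ A(t) ∈ L(V,E)` is norm continuous on `[0,∞)`. -/
  contA : ContinuousOn A (Set.Ici 0)

/-- `R` is the evolution system determined by the hyperbolic family `{A(t)}` (with
restriction data `ι`, constants `M`, `ω`): an evolution system satisfying the exponential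
bound, the forward derivative identity at `t = s` and the backward derivative identity
on `V`. -/
def IsDeterminedEvolutionSystem {V E : Type*}
    [NormedAddCommGroup V] [NormedSpace ℝ V]
    [NormedAddCommGroup E] [NormedSpace ℝ E]
    (iota : V →L[ℝ] E) (A : ℝ → (V →L[ℝ] E)) (M om : ℝ)
    (R : ℝ → ℝ → E →L[ℝ] E) : Prop :=
  IsEvolutionSystem R ∧
  (∀ t s : ℝ, 0 ≤ s → s ≤ t → ‖R t s‖ ≤ M * Real.exp (om * (t - s))) ∧
  (∀ s : ℝ, 0 ≤ s → ∀ v : V,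
    Filter.Tendsto (fun h : ℝ => h⁻¹ • (R (s + h) s (iota v) - iota v))
      (nhdsWithin 0 (Set.Ioi 0)) (nhds (A s v))) ∧
  (∀ t : ℝ, ∀ v : V, ∀ s ∈ Set.Icc (0:ℝ) t,
    HasDerivWithinAt (fun σ : ℝ => R t σ (iota v)) (-(R t s (A s v))) (Set.Icc 0 t) s)

namespace KatoAux

def ell (d : ℝ) (i : ℕ) (t s : ℝ) : ℝ :=
  (min t ((i + 1 : ℕ) * d) - min t (i * d)) - (min s ((i + 1 : ℕ) * d) - min s (i * d))

def Ug {X : Type*} [NormedAddCommGroup X] [NormedSpace ℝ X]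
    (S : ℝ → ℝ → X →L[ℝ] X) (d : ℝ) (N : ℕ) (t s : ℝ) : X →L[ℝ] X :=
  prodOps S (fun i => i * d) (fun i => ell d i t s) N

lemma ell_nonneg {d : ℝ} (hd : 0 < d) (i : ℕ) {t s : ℝ} (h : s ≤ t) : 0 ≤ ell d i t s := by
  unfold ell
  have : ((i + 1 : ℕ) : ℝ) * d = i * d + d := by push_cast; ring
  rw [this]
  rcases le_total t (i * d + d) with h1 | h1 <;> rcases le_total t (i * d) with h2 | h2 <;>
  rcases le_total s (i * d + d) with h3 | h3 <;> rcases le_total s (i * d) with h4 | h4 <;>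
  simp only [min_eq_left, min_eq_right, h1, h2, h3, h4] <;> linarith

lemma ell_sum (d : ℝ) (N : ℕ) {t s : ℝ} (hs : 0 ≤ s) (h : s ≤ t) :
    ∑ i ∈ Finset.range N, ell d i t s = min t (N * d) - min s (N * d) := by
  induction N with
  | zero => simp [hs, hs.trans h]
  | succ n ih => rw [Finset.sum_range_succ, ih]; unfold ell; ring

lemma ell_eq_zero_of_le {d : ℝ} (hd : 0 < d) (i : ℕ) {t s : ℝ} (h : s ≤ t)
    (h' : (i + 1 : ℕ) * d ≤ s) : ell d i t s = 0 := by
  unfold ell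
  have : ((i + 1 : ℕ) : ℝ) * d = i * d + d := by push_cast; ring
  rw [this] at h' ⊢
  rw [min_eq_right (by linarith), min_eq_right (by linarith), min_eq_right (by linarith),
    min_eq_right (by linarith)]; ring

lemma ell_eq_zero_of_ge {d : ℝ} (hd : 0 < d) (i : ℕ) {t s : ℝ} (h : s ≤ t)
    (h' : t ≤ i * d) : ell d i t s = 0 := by
  unfold ell
  have : ((i + 1 : ℕ) : ℝ) * d = i * d + d := by push_cast; ring
  rw [this]
  rw [min_eq_left (by linarith), min_eq_left (by linarith), min_eq_left (by linarith),
    min_eq_left (by linarith)]; ring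

lemma ell_eq {d : ℝ} (i : ℕ) {t s : ℝ} (h : s ≤ t)
    (h1 : i * d ≤ s) (h2 : t ≤ (i + 1 : ℕ) * d) : ell d i t s = t - s := by
  unfold ell
  rw [min_eq_left (by linarith), min_eq_right (by linarith), min_eq_left (by linarith),
    min_eq_right (by linarith)]; ring

section
variable {X : Type*} [NormedAddCommGroup X] [NormedSpace ℝ X] {S : ℝ → ℝ → X →L[ℝ] X}
  {M om : ℝ}

lemma Ug_norm (hst : IsStableFamily S M om) {d : ℝ} (hd : 0 < d) (N : ℕ) {t s : ℝ}
    (hs : 0 ≤ s) (h : s ≤ t) (hT : t ≤ N * d) :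
    ‖Ug S d N t s‖ ≤ M * Real.exp (om * (t - s)) := by
  have := hst N (fun i => i * d) (fun i => ell d i t s) (fun i => by positivity)
    (fun i j hij => by
      have : (i : ℝ) ≤ j := by exact_mod_cast hij
      exact mul_le_mul_of_nonneg_right this hd.le) (fun i => ell_nonneg hd i h)
  rw [ell_sum d N hs h, min_eq_left hT, min_eq_left (h.trans hT)] at this
  exact this

lemma prodOps_zero (hS : ∀ t, 0 ≤ t → IsC0Semigroup (S t)) {τ l : ℕ → ℝ} (hτ : ∀ i, 0 ≤ τ i)
    (N : ℕ) (hl : ∀ i < N, l i = 0) : prodOps S τ l N = ContinuousLinearMap.id ℝ X := by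
  induction N with
  | zero => rfl
  | succ n ih =>
    rw [prodOps, ih (fun i hi => hl i (by omega)), hl n (by omega), (hS _ (hτ n)).1]; rfl

lemma prodOps_single (hS : ∀ t, 0 ≤ t → IsC0Semigroup (S t)) {τ l : ℕ → ℝ} (hτ : ∀ i, 0 ≤ τ i)
    (N k : ℕ) (hk : k < N) (hl : ∀ i, i ≠ k → l i = 0) : prodOps S τ l N = S (τ k) (l k) := by
  induction N with
  | zero => omega
  | succ n ih =>
    rcases Nat.lt_succ_iff_lt_or_eq.1 hk with h | h
    · rw [prodOps, ih h, hl n (by omega), (hS _ (hτ n)).1]; rfl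
    · subst h
      rw [prodOps, prodOps_zero hS hτ k (fun i hi => hl i (by omega))]; rfl

lemma Ug_self (hS : ∀ t, 0 ≤ t → IsC0Semigroup (S t)) {d : ℝ} (hd : 0 < d) (N : ℕ) (t : ℝ) :
    Ug S d N t t = ContinuousLinearMap.id ℝ X :=
  prodOps_zero hS (fun i => by positivity) N (fun i _ => by simp [ell])

lemma Ug_comp (hS : ∀ t, 0 ≤ t → IsC0Semigroup (S t)) {d : ℝ} (hd : 0 < d) (N : ℕ) {t s r : ℝ}
    (hrs : r ≤ s) (hst : s ≤ t) : (Ug S d N t s).comp (Ug S d N s r) = Ug S d N t r := by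
  induction N with
  | zero => rfl
  | succ n ih =>
    have hτ : (0:ℝ) ≤ n * d := by positivity
    have hadd : ell d n t r = ell d n t s + ell d n s r := by unfold ell; ring
    have e : ∀ a b, Ug S d (n+1) a b = (S (n * d) (ell d n a b)).comp (Ug S d n a b) :=
      fun a b => rfl
    rw [e, e, e, ← ih, hadd, (hS _ hτ).2.1 _ _ (ell_nonneg hd n hst) (ell_nonneg hd n hrs)]
    rcases le_total s (n * d) with h | h
    · rw [ell_eq_zero_of_ge hd n hrs h, (hS _ hτ).1]; rfl
    · have : Ug S d n t s = ContinuousLinearMap.id ℝ X :=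
        prodOps_zero hS (fun i => by positivity) n (fun i hi => by
          apply ell_eq_zero_of_le hd i hst
          refine le_trans ?_ h
          have : ((i + 1 : ℕ) : ℝ) ≤ n := by exact_mod_cast hi
          exact mul_le_mul_of_nonneg_right this hd.le)
      rw [this]; rfl

lemma Ug_local (hS : ∀ t, 0 ≤ t → IsC0Semigroup (S t)) {d : ℝ} (hd : 0 < d) (N k : ℕ)
    (hk : k < N) {t s : ℝ} (hst : s ≤ t) (h1 : k * d ≤ s) (h2 : t ≤ (k + 1 : ℕ) * d) :
    Ug S d N t s = S (k * d) (t - s) := by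
  rw [← ell_eq k hst h1 h2]
  refine prodOps_single hS (τ := fun i : ℕ => (i:ℝ) * d) (l := fun i => ell d i t s)
    (fun i => by positivity) N k hk (fun i hi => ?_)
  rcases lt_or_gt_of_ne hi with h | h
  · apply ell_eq_zero_of_le hd i hst
    have : ((i + 1 : ℕ) : ℝ) ≤ k := by exact_mod_cast h
    exact (mul_le_mul_of_nonneg_right this hd.le).trans h1
  · apply ell_eq_zero_of_ge hd i hst
    have : ((k + 1 : ℕ) : ℝ) ≤ i := by exact_mod_cast h
    exact h2.trans (mul_le_mul_of_nonneg_right this hd.le)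

/-- joint limits of uniformly bounded strongly convergent operators -/
lemma tendsto_apply {α : Type*} {l : Filter α} {F : α → X →L[ℝ] X} {G : X →L[ℝ] X}
    {w : α → X} {u : X} {C : ℝ} (hb : ∀ᶠ a in l, ‖F a‖ ≤ C)
    (hF : Tendsto (fun a => F a u) l (𝓝 (G u))) (hw : Tendsto w l (𝓝 u)) :
    Tendsto (fun a => F a (w a)) l (𝓝 (G u)) := by
  have h1 : Tendsto (fun a => F a (w a - u)) l (𝓝 0) := by
    have h0 : Tendsto (fun a => C * ‖w a - u‖) l (𝓝 0) := by
      have := (tendsto_iff_norm_sub_tendsto_zero.1 hw).const_mul C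
      simpa using this
    refine squeeze_zero_norm' ?_ h0
    filter_upwards [hb] with a ha
    exact (F a).le_of_opNorm_le ha _
  have := h1.add hF
  simpa using this

lemma sem_bound (hst : IsStableFamily S M om) {τ h : ℝ} (hτ : 0 ≤ τ) (hh : 0 ≤ h) :
    ‖S τ h‖ ≤ M * Real.exp (om * h) := by
  have := hst 1 (fun _ => τ) (fun _ => h) (fun _ => hτ) (fun _ _ _ => le_rfl) (fun _ => hh)
  simpa [prodOps] using this

lemma Ug_cont (hS : ∀ t, 0 ≤ t → IsC0Semigroup (S t)) (hst : IsStableFamily S M om)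
    {d : ℝ} (hd : 0 < d) (N : ℕ) (u : X) :
    ContinuousOn (fun p : ℝ × ℝ => Ug S d N p.1 p.2 u) {p : ℝ × ℝ | 0 ≤ p.2 ∧ p.2 ≤ p.1} := by
  induction N with
  | zero => exact continuousOn_const
  | succ n ih =>
    intro p hp
    have hτ : (0:ℝ) ≤ n * d := by positivity
    have hel : Continuous (fun p : ℝ × ℝ => ell d n p.1 p.2) := by unfold ell; fun_prop
    have hmaps : MapsTo (fun p : ℝ × ℝ => ell d n p.1 p.2) {p : ℝ × ℝ | 0 ≤ p.2 ∧ p.2 ≤ p.1}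
        (Ici 0) := fun q hq => ell_nonneg hd n hq.2
    refine tendsto_apply (F := fun q : ℝ × ℝ => S (n * d) (ell d n q.1 q.2))
      (G := S (n * d) (ell d n p.1 p.2)) (w := fun q => Ug S d n q.1 q.2 u)
      (C := M * Real.exp (om * ell d n p.1 p.2) + 1) ?_ ?_ (ih p hp)
    · have hc : Continuous (fun p : ℝ × ℝ => M * Real.exp (om * ell d n p.1 p.2)) := by fun_prop
      have : ∀ᶠ q in 𝓝 p, M * Real.exp (om * ell d n q.1 q.2)
          < M * Real.exp (om * ell d n p.1 p.2) + 1 :=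
        (hc.tendsto p).eventually_lt_const (by linarith)
      filter_upwards [mem_nhdsWithin_of_mem_nhds this, self_mem_nhdsWithin] with q h1 hq
      exact (sem_bound hst hτ (hmaps hq)).trans (le_of_lt h1)
    · exact (((hS _ hτ).2.2 (Ug S d n p.1 p.2 u)).comp hel.continuousOn hmaps) p hp

end

lemma Ug_compat {V E : Type*} [NormedAddCommGroup V] [NormedSpace ℝ V]
    [NormedAddCommGroup E] [NormedSpace ℝ E] {iota : V →L[ℝ] E} {S : ℝ → ℝ → E →L[ℝ] E}
    {SV : ℝ → ℝ → V →L[ℝ] V}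
    (hc : ∀ t h : ℝ, 0 ≤ t → 0 ≤ h → ∀ v : V, iota (SV t h v) = S t h (iota v))
    {d : ℝ} (hd : 0 < d) (N : ℕ) {t s : ℝ} (hst : s ≤ t) (v : V) :
    iota (Ug SV d N t s v) = Ug S d N t s (iota v) := by
  induction N with
  | zero => rfl
  | succ n ih =>
    have hτ : (0:ℝ) ≤ n * d := by positivity
    change iota (SV (n * d) (ell d n t s) (Ug SV d n t s v)) = S (n * d) (ell d n t s) (Ug S d n t s (iota v))
    rw [hc _ _ hτ (ell_nonneg hd n hst), ih]

section
variable {E : Type*} [NormedAddCommGroup E] [NormedSpace ℝ E]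

lemma tendsto_sub_right (r : ℝ) : Tendsto (fun y => y - r) (𝓝[>] r) (𝓝[>] 0) := by
  refine tendsto_nhdsWithin_iff.2 ⟨?_, ?_⟩
  · have : Tendsto (fun y : ℝ => y - r) (𝓝 r) (𝓝 (r - r)) := by
      exact (continuous_id.sub continuous_const).tendsto r
    rw [sub_self] at this
    exact this.mono_left nhdsWithin_le_nhds
  · filter_upwards [self_mem_nhdsWithin] with y hy
    exact sub_pos.2 (by simpa using hy)

lemma tendsto_sub_left (r : ℝ) : Tendsto (fun y => r - y) (𝓝[<] r) (𝓝[>] 0) := by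
  refine tendsto_nhdsWithin_iff.2 ⟨?_, ?_⟩
  · have : Tendsto (fun y : ℝ => r - y) (𝓝 r) (𝓝 (r - r)) := by
      exact (continuous_const.sub continuous_id).tendsto r
    rw [sub_self] at this
    exact this.mono_left nhdsWithin_le_nhds
  · filter_upwards [self_mem_nhdsWithin] with y hy
    exact sub_pos.2 (by simpa using hy)

lemma tendsto_add_right (r : ℝ) : Tendsto (fun h => r + h) (𝓝[>] 0) (𝓝[>] r) := by
  refine tendsto_nhdsWithin_iff.2 ⟨?_, ?_⟩
  · have : Tendsto (fun y : ℝ => r + y) (𝓝 0) (𝓝 (r + 0)) := by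
      exact (continuous_const.add continuous_id).tendsto 0
    rw [add_zero] at this
    exact this.mono_left nhdsWithin_le_nhds
  · filter_upwards [self_mem_nhdsWithin] with y hy
    exact lt_add_of_pos_right r hy

lemma hasDeriv_right {f : ℝ → E} {f' : E} {r : ℝ}
    (h : Tendsto (fun h : ℝ => h⁻¹ • (f (r + h) - f r)) (𝓝[>] 0) (𝓝 f')) :
    HasDerivWithinAt f f' (Ici r) r := by
  rw [← hasDerivWithinAt_Ioi_iff_Ici, hasDerivWithinAt_iff_tendsto_slope' self_notMem_Ioi]
  refine (h.comp (tendsto_sub_right r)).congr (fun y => ?_)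
  simp [slope_def_module]

lemma hasDeriv_left {f : ℝ → E} {f' : E} {r : ℝ}
    (h : Tendsto (fun h : ℝ => h⁻¹ • (f r - f (r - h))) (𝓝[>] 0) (𝓝 f')) :
    HasDerivWithinAt f f' (Iic r) r := by
  rw [← hasDerivWithinAt_Iio_iff_Iic, hasDerivWithinAt_iff_tendsto_slope' self_notMem_Iio]
  refine (h.comp (tendsto_sub_left r)).congr (fun y => ?_)
  have : (y - r)⁻¹ = - (r - y)⁻¹ := by rw [← inv_neg]; congr 1; ring
  simp only [slope_def_module, Function.comp, sub_sub_cancel, this]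
  rw [neg_smul, ← smul_neg, neg_sub]

end

structure Pre {V E : Type*} [NormedAddCommGroup V] [NormedSpace ℝ V]
    [NormedAddCommGroup E] [NormedSpace ℝ E] (iota : V →L[ℝ] E)
    (W : ℝ → ℝ → E →L[ℝ] E) (B : ℝ → V →L[ℝ] E) (T C : ℝ) : Prop where
  self : ∀ t, 0 ≤ t → W t t = ContinuousLinearMap.id ℝ E
  comp : ∀ t s r, 0 ≤ r → r ≤ s → s ≤ t → (W t s).comp (W s r) = W t r
  cont : ∀ u : E, ContinuousOn (fun p : ℝ × ℝ => W p.1 p.2 u) {p : ℝ × ℝ | 0 ≤ p.2 ∧ p.2 ≤ p.1}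
  bound : ∀ t s, 0 ≤ s → s ≤ t → t ≤ T → ‖W t s‖ ≤ C
  der : ∀ s, 0 ≤ s → s < T → ∀ v : V,
    Tendsto (fun h : ℝ => h⁻¹ • (W (s + h) s (iota v) - iota v)) (𝓝[>] 0) (𝓝 (B s v))

section
variable {V E : Type*} [NormedAddCommGroup V] [NormedSpace ℝ V]
    [NormedAddCommGroup E] [NormedSpace ℝ E] {iota : V →L[ℝ] E}
    {W U : ℝ → ℝ → E →L[ℝ] E} {B B' : ℝ → V →L[ℝ] E} {T C C' : ℝ}

lemma Pre.cont_right (hW : Pre iota W B T C) (t : ℝ) (u : E) :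
    ContinuousOn (fun r => W t r u) (Icc 0 t) :=
  (hW.cont u).comp (f := fun r : ℝ => (t, r)) (by fun_prop) (fun _ hr => hr)

lemma Pre.cont_left (hW : Pre iota W B T C) {s : ℝ} (hs : 0 ≤ s) (u : E) :
    ContinuousOn (fun r => W r s u) (Ici s) :=
  (hW.cont u).comp (f := fun r : ℝ => (r, s)) (by fun_prop) (fun _ hr => ⟨hs, hr⟩)

lemma Pre.right_deriv (hW : Pre iota W B T C) {t r : ℝ} (hr : 0 ≤ r) (hrt : r < t) (htT : t ≤ T)
    {z : ℝ → E} {z' : E} {v : V} (hz : z r = iota v)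
    (hz' : Tendsto (fun h : ℝ => h⁻¹ • (z (r + h) - z r)) (𝓝[>] 0) (𝓝 z')) :
    HasDerivWithinAt (fun σ => W t σ (z σ)) (W t r (z' - B r v)) (Ici r) r := by
  apply hasDeriv_right
  have hev : ∀ᶠ h : ℝ in 𝓝[>] 0, r + h < t ∧ 0 < h := by
    filter_upwards [(tendsto_add_right r).eventually
      (mem_nhdsWithin_of_mem_nhds (Iio_mem_nhds hrt)), self_mem_nhdsWithin] with h h1 h2
    exact ⟨h1, h2⟩
  have h1 := hz'.sub (hW.der r hr (hrt.trans_le htT) v)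
  have h2 : Tendsto (fun h : ℝ => W t (r + h) (z' - B r v)) (𝓝[>] 0) (𝓝 (W t r (z' - B r v))) := by
    have hc := hW.cont_right t (z' - B r v) r ⟨hr, hrt.le⟩
    have hm : Tendsto (fun h => r + h) (𝓝[>] 0) (𝓝[Icc 0 t] r) := by
      refine tendsto_nhdsWithin_iff.2 ⟨(tendsto_add_right r).mono_right nhdsWithin_le_nhds, ?_⟩
      filter_upwards [hev] with h hh
      exact ⟨by linarith, hh.1.le⟩
    exact hc.tendsto.comp hm
  have h3 := tendsto_apply (F := fun h : ℝ => W t (r + h)) (G := W t r) (C := C) (by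
    filter_upwards [hev] with h hh
    exact hW.bound t (r + h) (by linarith) hh.1.le htT) h2 h1
  refine h3.congr' ?_
  filter_upwards [hev] with h hh
  rw [← smul_sub, map_smul]
  congr 1
  have hc := hW.comp t (r + h) r hr (by linarith) hh.1.le
  rw [hz, ← hc]
  simp

lemma Pre.compare (hW : Pre iota W B T C) (hU : Pre iota U B' T C')
    {UV : ℝ → V →L[ℝ] V} {t s K ε : ℝ} (hs : 0 ≤ s) (hst : s ≤ t) (htT : t ≤ T)
    (hUV : ∀ r, s ≤ r → ∀ v, iota (UV r v) = U r s (iota v))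
    (hUVb : ∀ r, s ≤ r → r ≤ t → ‖UV r‖ ≤ K)
    (hB : ∀ r, s ≤ r → r < t → ‖B' r - B r‖ ≤ ε) (v : V) :
    ‖U t s (iota v) - W t s (iota v)‖ ≤ C * (ε * (K * ‖v‖)) * (t - s) := by
  have hcont : ContinuousOn (fun r => W t r (U r s (iota v))) (Icc s t) := by
    intro r hr
    refine tendsto_apply (F := fun r => W t r) (G := W t r) (C := C)
      (w := fun r => U r s (iota v)) ?_ ?_ ?_
    · filter_upwards [self_mem_nhdsWithin] with q hq
      exact hW.bound t q (hs.trans hq.1) hq.2 htT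
    · exact (hW.cont_right t _).mono (Icc_subset_Icc_left hs) r hr
    · exact (hU.cont_left hs _).mono (fun q hq => hq.1) r hr
  have hd : ∀ r ∈ Ico s t, HasDerivWithinAt (fun r => W t r (U r s (iota v)))
      (W t r (B' r (UV r v) - B r (UV r v))) (Ici r) r := by
    intro r hr
    refine hW.right_deriv (hs.trans hr.1) hr.2 htT (z := fun r => U r s (iota v))
      (hUV r hr.1 v).symm ?_
    refine (hU.der r (hs.trans hr.1) (hr.2.trans_le htT) (UV r v)).congr' ?_
    filter_upwards [self_mem_nhdsWithin] with h hh
    have hh : 0 < h := hh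
    rw [hUV r hr.1, ← hU.comp (r + h) r s hs hr.1 (by linarith)]
    rfl
  have hb : ∀ r ∈ Ico s t, ‖W t r (B' r (UV r v) - B r (UV r v))‖ ≤ C * (ε * (K * ‖v‖)) := by
    intro r hr
    refine (W t r).le_of_opNorm_le_of_le (hW.bound t r (hs.trans hr.1) hr.2.le htT) ?_
    refine (B' r - B r).le_of_opNorm_le_of_le (hB r hr.1 hr.2) ?_
    exact (UV r).le_of_opNorm_le (hUVb r hr.1 hr.2.le) v
  have := norm_image_sub_le_of_norm_deriv_right_le_segment hcont hd hb t ⟨hst, le_rfl⟩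
  simpa [hW.self t (hs.trans hst), hU.self s hs] using this

end

noncomputable def CC (M om T : ℝ) : ℝ := M * Real.exp (|om| * T)

lemma le_CC {M om T a : ℝ} (hM : 1 ≤ M) (ha : 0 ≤ a) (haT : a ≤ T) :
    M * Real.exp (om * a) ≤ CC M om T := by
  unfold CC
  refine mul_le_mul_of_nonneg_left (Real.exp_le_exp.2 ?_) (by linarith)
  exact (mul_le_mul_of_nonneg_right (le_abs_self om) ha).trans
    (mul_le_mul_of_nonneg_left haT (abs_nonneg om))

lemma CC_pos {M om T : ℝ} (hM : 1 ≤ M) : 0 < CC M om T :=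
  mul_pos (by linarith) (Real.exp_pos _)

noncomputable def Un {X : Type*} [NormedAddCommGroup X] [NormedSpace ℝ X]
    (S : ℝ → ℝ → X →L[ℝ] X) (n : ℕ) (t s : ℝ) : X →L[ℝ] X :=
  Ug S ((n : ℝ) + 1)⁻¹ ((n + 1) ^ 2) t s

noncomputable def Bn {V E : Type*} [NormedAddCommGroup V] [NormedSpace ℝ V]
    [NormedAddCommGroup E] [NormedSpace ℝ E] (A : ℝ → V →L[ℝ] E) (n : ℕ) (r : ℝ) : V →L[ℝ] E :=
  A (⌊r * (n + 1)⌋₊ * ((n : ℝ) + 1)⁻¹)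

lemma dpos (n : ℕ) : (0:ℝ) < ((n : ℝ) + 1)⁻¹ := by positivity

lemma Nd (n : ℕ) : (((n + 1) ^ 2 : ℕ) : ℝ) * ((n : ℝ) + 1)⁻¹ = n + 1 := by
  have : (n : ℝ) + 1 ≠ 0 := by positivity
  push_cast; field_simp

lemma Un_norm {X : Type*} [NormedAddCommGroup X] [NormedSpace ℝ X]
    {S : ℝ → ℝ → X →L[ℝ] X} {M om : ℝ} (hst : IsStableFamily S M om) {n : ℕ} {t s : ℝ}
    (hs : 0 ≤ s) (h : s ≤ t) (hT : t ≤ n + 1) :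
    ‖Un S n t s‖ ≤ M * Real.exp (om * (t - s)) :=
  Ug_norm hst (dpos n) _ hs h (by rw [Nd]; exact hT)

section
variable {V E : Type*} [NormedAddCommGroup V] [NormedSpace ℝ V]
    [NormedAddCommGroup E] [NormedSpace ℝ E] {iota : V →L[ℝ] E}
    {A : ℝ → (V →L[ℝ] E)} {S : ℝ → ℝ → E →L[ℝ] E} {SV : ℝ → ℝ → V →L[ℝ] V}
    {M om MV omV : ℝ}

lemma Bn_close (hA : ContinuousOn A (Ici 0)) (T : ℝ) {ε : ℝ} (hε : 0 < ε) :
    ∀ᶠ n : ℕ in atTop, ∀ r ∈ Icc 0 T, ‖Bn A n r - A r‖ ≤ ε := by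
  have huc : UniformContinuousOn A (Icc 0 T) :=
    isCompact_Icc.uniformContinuousOn_of_continuous (hA.mono (fun x hx => hx.1))
  obtain ⟨δ, hδ, H⟩ := Metric.uniformContinuousOn_iff.1 huc ε hε
  have h0 : ∀ᶠ n : ℕ in atTop, 1 / ((n : ℝ) + 1) < δ :=
    tendsto_one_div_add_atTop_nhds_zero_nat.eventually_lt_const hδ
  filter_upwards [h0] with n hn r hr
  have hp : (0:ℝ) < n + 1 := by positivity
  have h1 : (⌊r * (n + 1)⌋₊ : ℝ) ≤ r * (n + 1) := Nat.floor_le (mul_nonneg hr.1 hp.le)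
  have h2 : r * (n + 1) < (⌊r * (n + 1)⌋₊ : ℝ) + 1 := Nat.lt_floor_add_one _
  have h3 : (⌊r * (n + 1)⌋₊ : ℝ) * ((n : ℝ) + 1)⁻¹ ≤ r := by
    rw [← div_eq_mul_inv, div_le_iff₀ hp]; exact h1
  have h4 : r < (⌊r * (n + 1)⌋₊ : ℝ) * ((n : ℝ) + 1)⁻¹ + 1 / ((n : ℝ) + 1) := by
    rw [← div_eq_mul_inv, ← add_div, lt_div_iff₀ hp]; exact h2
  have := H _ ⟨by positivity, h3.trans hr.2⟩ r hr (by
    rw [dist_comm, Real.dist_eq, abs_of_nonneg (by linarith)]; linarith)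
  rw [dist_eq_norm] at this
  exact this.le

lemma Pre_Un (h : IsHyperbolicFamily iota A S SV M om MV omV) (hM : 1 ≤ M) {n : ℕ} {T : ℝ}
    (hT : T ≤ n + 1) : Pre iota (Un S n) (Bn A n) T (CC M om T) where
  self t _ := Ug_self h.sem_E (dpos n) _ t
  comp t s r _ hrs hst := Ug_comp h.sem_E (dpos n) _ hrs hst
  cont u := Ug_cont h.sem_E h.stable_E (dpos n) _ u
  bound t s hs hst htT := (Un_norm h.stable_E hs hst (htT.trans hT)).trans
    (le_CC hM (by linarith) (by linarith))
  der s hs hsT v := by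
    have hp : (0:ℝ) < n + 1 := by positivity
    set k := ⌊s * (n + 1)⌋₊ with hk
    have h1 : (k : ℝ) ≤ s * (n + 1) := Nat.floor_le (mul_nonneg hs hp.le)
    have h2 : s * (n + 1) < ((k + 1 : ℕ) : ℝ) := by push_cast; exact Nat.lt_floor_add_one _
    have h3 : (k : ℝ) * ((n : ℝ) + 1)⁻¹ ≤ s := by
      rw [← div_eq_mul_inv, div_le_iff₀ hp]; exact h1
    have h4 : s < ((k + 1 : ℕ) : ℝ) * ((n : ℝ) + 1)⁻¹ := by
      rw [← div_eq_mul_inv, lt_div_iff₀ hp]; exact h2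
    have hkN : k < (n + 1) ^ 2 := by
      have : (k : ℝ) < ((n + 1) ^ 2 : ℕ) := by
        push_cast
        nlinarith
      exact_mod_cast this
    refine (h.gen_on_V (k * ((n : ℝ) + 1)⁻¹) (by positivity) v).congr' ?_
    filter_upwards [(tendsto_add_right s).eventually
      (mem_nhdsWithin_of_mem_nhds (Iio_mem_nhds h4)), self_mem_nhdsWithin] with x hx hx0
    have hx0 : 0 < x := hx0
    have e : Un S n (s + x) s = S (k * ((n : ℝ) + 1)⁻¹) x := by
      have := Ug_local h.sem_E (dpos n) _ k hkN (t := s + x) (s := s) (by linarith) h3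
        (le_of_lt hx)
      rw [add_sub_cancel_left] at this
      exact this
    rw [e]

lemma Pre_S (h : IsHyperbolicFamily iota A S SV M om MV omV) (hM : 1 ≤ M) {τ : ℝ} (hτ : 0 ≤ τ)
    (T : ℝ) : Pre iota (fun t s => S τ (t - s)) (fun _ => A τ) T (CC M om T) where
  self t _ := by simpa using (h.sem_E τ hτ).1
  comp t s r _ hrs hst := by
    rw [← (h.sem_E τ hτ).2.1 _ _ (by linarith) (by linarith)]
    congr 1; ring
  cont u := ((h.sem_E τ hτ).2.2 u).comp (f := fun p : ℝ × ℝ => p.1 - p.2) (by fun_prop)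
    (fun p hp => sub_nonneg.2 hp.2)
  bound t s hs hst htT := (sem_bound h.stable_E hτ (by linarith)).trans
    (le_CC hM (by linarith) (by linarith))
  der s hs hsT v := by simpa using h.gen_on_V τ hτ v

lemma Pre_det {R : ℝ → ℝ → E →L[ℝ] E} (h : IsEvolutionSystem R) (hM : 1 ≤ M)
    (hb : ∀ t s : ℝ, 0 ≤ s → s ≤ t → ‖R t s‖ ≤ M * Real.exp (om * (t - s)))
    (hd : ∀ s : ℝ, 0 ≤ s → ∀ v : V,
      Tendsto (fun h : ℝ => h⁻¹ • (R (s + h) s (iota v) - iota v)) (𝓝[>] 0) (𝓝 (A s v)))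
    (T : ℝ) : Pre iota R A T (CC M om T) where
  self := h.1
  comp := h.2.1
  cont := h.2.2
  bound t s hs hst htT := (hb t s hs hst).trans (le_CC hM (by linarith) (by linarith))
  der s hs _ v := hd s hs v

/-- comparison of `Un` with any pre-evolution system -/
lemma Un_compare (h : IsHyperbolicFamily iota A S SV M om MV omV) (hM : 1 ≤ M) (hMV : 1 ≤ MV)
    {n : ℕ} {T : ℝ} (hT : T ≤ n + 1) {W : ℝ → ℝ → E →L[ℝ] E} {B : ℝ → V →L[ℝ] E}
    (hW : Pre iota W B T (CC M om T)) {t s ε : ℝ} (hs : 0 ≤ s) (hst : s ≤ t) (htT : t ≤ T)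
    (hB : ∀ r, s ≤ r → r < t → ‖Bn A n r - B r‖ ≤ ε) (v : V) :
    ‖Un S n t s (iota v) - W t s (iota v)‖
      ≤ CC M om T * (ε * (CC MV omV T * ‖v‖)) * (t - s) :=
  hW.compare (Pre_Un h hM hT) (UV := fun r => Un SV n r s) hs hst htT
    (fun r hr v => Ug_compat h.compat (dpos n) _ hr v)
    (fun r hr hrt => (Un_norm h.stable_V hs hr (by linarith)).trans
      (le_CC hMV (by linarith) (by linarith))) hB v

lemma ev_le (T : ℝ) : ∀ᶠ n : ℕ in atTop, T ≤ (n : ℝ) + 1 := by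
  filter_upwards [tendsto_natCast_atTop_atTop.eventually (eventually_ge_atTop T)] with n hn
  linarith

lemma exists_eps {a T : ℝ} (ha : 0 ≤ a) (hT : 0 ≤ T) {η : ℝ} (hη : 0 < η) :
    ∃ ε > 0, ∀ x, 0 ≤ x → x ≤ T → ε * a * x ≤ η := by
  refine ⟨η / (a * T + 1), by positivity, fun x hx hxT => ?_⟩
  rw [div_mul_eq_mul_div, div_mul_eq_mul_div, div_le_iff₀ (by positivity)]
  nlinarith [mul_le_mul_of_nonneg_left hxT ha]

lemma Un_cauchy (h : IsHyperbolicFamily iota A S SV M om MV omV) (hM : 1 ≤ M) (hMV : 1 ≤ MV)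
    (hdense : DenseRange iota) {T : ℝ} (hT : 0 ≤ T) (u : E) :
    UniformCauchySeqOn (fun n (p : ℝ × ℝ) => Un S n p.1 p.2 u) atTop
      {p : ℝ × ℝ | 0 ≤ p.2 ∧ p.2 ≤ p.1 ∧ p.1 ≤ T} := by
  rw [Metric.uniformCauchySeqOn_iff]
  intro η hη
  have hC := CC_pos (om := om) (T := T) hM
  have hCV := CC_pos (om := omV) (T := T) hMV
  obtain ⟨v, hv⟩ : ∃ v, ‖u - iota v‖ < η / (4 * CC M om T) := by
    obtain ⟨v, hv⟩ := hdense.exists_dist_lt u (show 0 < η / (4 * CC M om T) by positivity)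
    exact ⟨v, by rwa [← dist_eq_norm]⟩
  obtain ⟨ε, hε, H⟩ := exists_eps (a := CC M om T * (CC MV omV T * ‖v‖)) (T := T) (by positivity)
    hT (show 0 < η / 4 by positivity)
  obtain ⟨N, hN⟩ := eventually_atTop.1 ((ev_le T).and
    (Bn_close h.contA T (show 0 < ε / 2 by positivity)))
  refine ⟨N, fun m hm n hn p hp => ?_⟩
  obtain ⟨h1, h2, h3⟩ := hp
  have key := Un_compare h hM hMV (hN m hm).1 (Pre_Un h hM (hN n hn).1) (ε := ε) h1 h2 h3
    (fun r hr hrt => by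
      have a1 := (hN m hm).2 r ⟨h1.trans hr, (hrt.le.trans h3)⟩
      have a2 := (hN n hn).2 r ⟨h1.trans hr, (hrt.le.trans h3)⟩
      have : Bn A m r - Bn A n r = (Bn A m r - A r) - (Bn A n r - A r) := by abel
      rw [this]
      exact (norm_sub_le _ _).trans (by linarith)) v
  have key2 := H (p.1 - p.2) (by linarith) (by linarith)
  have bd : ∀ k, N ≤ k → ‖Un S k p.1 p.2 (u - iota v)‖ ≤ η / 4 := by
    intro k hk
    have := (Un S k p.1 p.2).le_of_opNorm_le_of_le
      ((Pre_Un h hM (hN k hk).1).bound p.1 p.2 h1 h2 h3) hv.le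
    refine this.trans (le_of_eq ?_)
    field_simp
  have e : Un S m p.1 p.2 u - Un S n p.1 p.2 u = Un S m p.1 p.2 (u - iota v)
      - Un S n p.1 p.2 (u - iota v) + (Un S m p.1 p.2 (iota v) - Un S n p.1 p.2 (iota v)) := by
    simp only [map_sub]; abel
  rw [dist_eq_norm, e]
  have n1 := norm_add_le (Un S m p.1 p.2 (u - iota v)
      - Un S n p.1 p.2 (u - iota v)) (Un S m p.1 p.2 (iota v) - Un S n p.1 p.2 (iota v))
  have n2 := norm_sub_le (Un S m p.1 p.2 (u - iota v)) (Un S n p.1 p.2 (u - iota v))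
  have b1 := bd m hm
  have b2 := bd n hn
  have : CC M om T * (ε * (CC MV omV T * ‖v‖)) * (p.1 - p.2) =
    ε * (CC M om T * (CC MV omV T * ‖v‖)) * (p.1 - p.2) := by ring
  linarith

end

section
variable {V E : Type*} [NormedAddCommGroup V] [NormedSpace ℝ V]
    [NormedAddCommGroup E] [NormedSpace ℝ E] {iota : V →L[ℝ] E}
    {A : ℝ → (V →L[ℝ] E)} {S : ℝ → ℝ → E →L[ℝ] E} {SV : ℝ → ℝ → V →L[ℝ] V}
    {M om MV omV : ℝ} {R : ℝ → ℝ → E →L[ℝ] E}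

lemma exists_lim [CompleteSpace E] (h : IsHyperbolicFamily iota A S SV M om MV omV) (hM : 1 ≤ M)
    (hMV : 1 ≤ MV) (hdense : DenseRange iota) :
    ∃ R : ℝ → ℝ → E →L[ℝ] E, ∀ t s, 0 ≤ s → s ≤ t → ∀ u,
      Tendsto (fun n => Un S n t s u) atTop (𝓝 (R t s u)) := by
  have : ∀ t s, ∃ R : E →L[ℝ] E, 0 ≤ s → s ≤ t → ∀ u,
      Tendsto (fun n => Un S n t s u) atTop (𝓝 (R u)) := by
    intro t s
    by_cases hc : 0 ≤ s ∧ s ≤ t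
    · have hl : ∀ u, ∃ l, Tendsto (fun n => Un S n t s u) atTop (𝓝 l) := fun u =>
        by
          have hu := Un_cauchy h hM hMV hdense (hc.1.trans hc.2) u
          have hx : ((t, s) : ℝ × ℝ) ∈ {p : ℝ × ℝ | 0 ≤ p.2 ∧ p.2 ≤ p.1 ∧ p.1 ≤ t} :=
            ⟨hc.1, hc.2, le_rfl⟩
          have hcs := UniformCauchySeqOn.cauchySeq hu hx
          dsimp only at hcs
          exact cauchySeq_tendsto_of_complete hcs
      choose f hf using hl
      have hf' : Tendsto (fun (n : ℕ) (x : E) => Un S n t s x) atTop (𝓝 f) := tendsto_pi_nhds.2 hf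
      exact ⟨continuousLinearMapOfTendsto (fun n : ℕ => Un S n t s) hf', fun _ _ u => hf u⟩
    · exact ⟨0, fun h1 h2 => absurd ⟨h1, h2⟩ hc⟩
  choose R hR using this
  exact ⟨R, hR⟩

lemma lim_evol (h : IsHyperbolicFamily iota A S SV M om MV omV) (hM : 1 ≤ M)
    (hMV : 1 ≤ MV) (hdense : DenseRange iota)
    (hR : ∀ t s, 0 ≤ s → s ≤ t → ∀ u, Tendsto (fun n => Un S n t s u) atTop (𝓝 (R t s u))) :
    IsEvolutionSystem R := by
  refine ⟨fun t ht => ?_, fun t s r hr hrs hst => ?_, fun u p hp => ?_⟩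
  · ext u
    refine tendsto_nhds_unique (hR t t ht le_rfl u) ?_
    have : ∀ n, Un S n t t u = u := fun n => by
      rw [(Pre_Un h hM (T := n + 1) le_rfl).self t ht]; rfl
    simp [this]
  · ext u
    have h1 := tendsto_apply (F := fun n => Un S n t s) (G := R t s) (C := CC M om t) (by
        filter_upwards [ev_le t] with n hn
        exact (Pre_Un h hM hn).bound t s (hr.trans hrs) hst le_rfl)
      (hR t s (hr.trans hrs) hst (R s r u)) (hR s r hr hrs u)
    refine tendsto_nhds_unique h1 ((hR t r hr (hrs.trans hst) u).congr fun n => ?_)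
    rw [← (Pre_Un h hM (T := n + 1) le_rfl).comp t s r hr hrs hst]; rfl
  · have hp0 : 0 ≤ p.1 + 1 := by linarith [hp.1, hp.2]
    have hu : TendstoUniformlyOn (fun n (p : ℝ × ℝ) => Un S n p.1 p.2 u) (fun p => R p.1 p.2 u)
        atTop {q : ℝ × ℝ | 0 ≤ q.2 ∧ q.2 ≤ q.1 ∧ q.1 ≤ p.1 + 1} :=
      (Un_cauchy h hM hMV hdense hp0 u).tendstoUniformlyOn_of_tendsto
        (fun q hq => hR q.1 q.2 hq.1 hq.2.1 u)
    have hcn : ∀ n : ℕ, ContinuousOn (fun p : ℝ × ℝ => Un S n p.1 p.2 u)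
        {q : ℝ × ℝ | 0 ≤ q.2 ∧ q.2 ≤ q.1 ∧ q.1 ≤ p.1 + 1} := fun n =>
      ((Pre_Un h hM (T := (n : ℝ) + 1) le_rfl).cont u).mono (fun q hq => ⟨hq.1, hq.2.1⟩)
    have hc := hu.continuousOn (Eventually.of_forall hcn).frequently
    refine (hc p ⟨hp.1, hp.2, by linarith⟩).mono_of_mem_nhdsWithin ?_
    have hop : {q : ℝ × ℝ | q.1 < p.1 + 1} ∈ 𝓝 p :=
      (isOpen_lt continuous_fst continuous_const).mem_nhds (show p.1 < p.1 + 1 by linarith)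
    filter_upwards [mem_nhdsWithin_of_mem_nhds hop, self_mem_nhdsWithin] with q h1 h2
    exact ⟨h2.1, h2.2, le_of_lt h1⟩

lemma lim_bound (h : IsHyperbolicFamily iota A S SV M om MV omV) (hM : 1 ≤ M)
    (hR : ∀ t s, 0 ≤ s → s ≤ t → ∀ u, Tendsto (fun n => Un S n t s u) atTop (𝓝 (R t s u)))
    (t s : ℝ) (hs : 0 ≤ s) (hst : s ≤ t) : ‖R t s‖ ≤ M * Real.exp (om * (t - s)) := by
  refine ContinuousLinearMap.opNorm_le_bound _ (mul_nonneg (by linarith) (Real.exp_pos _).le)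
    fun u => ?_
  refine le_of_tendsto (hR t s hs hst u).norm ?_
  filter_upwards [ev_le t] with n hn
  exact (Un S n t s).le_of_opNorm_le (Un_norm h.stable_E hs hst hn) u

/-- the key local comparison with the frozen semigroup -/
lemma lim_local (h : IsHyperbolicFamily iota A S SV M om MV omV) (hM : 1 ≤ M) (hMV : 1 ≤ MV)
    (hR : ∀ t s, 0 ≤ s → s ≤ t → ∀ u, Tendsto (fun n => Un S n t s u) atTop (𝓝 (R t s u)))
    {τ : ℝ} (hτ : 0 ≤ τ) (v : V) {η : ℝ} (hη : 0 < η) :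
    ∃ δ > 0, ∀ t s, 0 ≤ s → s ≤ t → τ - δ < s → t < τ + δ →
      ‖R t s (iota v) - S τ (t - s) (iota v)‖ ≤ η * (t - s) := by
  have hC := CC_pos (om := om) (T := τ + 1) hM
  have hCV := CC_pos (om := omV) (T := τ + 1) hMV
  obtain ⟨ε, hε, H⟩ := exists_eps (a := CC M om (τ + 1) * (CC MV omV (τ + 1) * ‖v‖)) (T := 1)
    (by positivity) zero_le_one hη
  have H1 := H 1 zero_le_one le_rfl
  obtain ⟨δ, hδ, Hδ⟩ := Metric.continuousOn_iff.1 h.contA τ hτ (ε / 2) (by positivity)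
  refine ⟨min δ 1, by positivity, fun t s hs hst h1 h2 => ?_⟩
  have hd1 : min δ 1 ≤ δ := min_le_left _ _
  have hd2 : min δ 1 ≤ 1 := min_le_right _ _
  refine le_of_tendsto ((hR t s hs hst (iota v)).sub_const _).norm ?_
  filter_upwards [ev_le (τ + 1), Bn_close h.contA (τ + 1) (show 0 < ε / 2 by positivity)]
    with n hn hn2
  have key := Un_compare h hM hMV hn (Pre_S h hM hτ (τ + 1)) (ε := ε) hs hst (by linarith)
    (fun r hr hrt => by
      have a1 := hn2 r ⟨hs.trans hr, by linarith⟩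
      have a2 := Hδ r (hs.trans hr) (by rw [Real.dist_eq, abs_lt]; constructor <;> linarith)
      rw [dist_eq_norm] at a2
      have : Bn A n r - A τ = (Bn A n r - A r) + (A r - A τ) := by abel
      rw [this]
      exact (norm_add_le _ _).trans (by linarith)) v
  refine key.trans (mul_le_mul_of_nonneg_right ?_ (by linarith))
  calc _ = ε * (CC M om (τ + 1) * (CC MV omV (τ + 1) * ‖v‖)) * 1 := by ring
    _ ≤ η := H1

/-- any choice of intervals `[a h, a h + h]` near `τ` gives the generator -/
lemma lim_quot (h : IsHyperbolicFamily iota A S SV M om MV omV) (hM : 1 ≤ M) (hMV : 1 ≤ MV)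
    (hR : ∀ t s, 0 ≤ s → s ≤ t → ∀ u, Tendsto (fun n => Un S n t s u) atTop (𝓝 (R t s u)))
    {τ : ℝ} (hτ : 0 ≤ τ) (v : V) {a b : ℝ → ℝ} (hab : ∀ x, b x - a x = x)
    (ha : Tendsto a (𝓝[>] 0) (𝓝 τ)) (hb : Tendsto b (𝓝[>] 0) (𝓝 τ))
    (ha0 : ∀ᶠ x in 𝓝[>] 0, 0 ≤ a x) :
    Tendsto (fun x : ℝ => x⁻¹ • (R (b x) (a x) (iota v) - iota v)) (𝓝[>] 0) (𝓝 (A τ v)) := by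
  have h1 := h.gen_on_V τ hτ v
  have h2 : Tendsto (fun x : ℝ => x⁻¹ • (R (b x) (a x) (iota v) - S τ x (iota v)))
      (𝓝[>] 0) (𝓝 0) := by
    rw [NormedAddGroup.tendsto_nhds_zero]
    intro η hη
    obtain ⟨δ, hδ, H⟩ := lim_local h hM hMV hR hτ v (show 0 < η / 2 by positivity)
    filter_upwards [ha0, ha.eventually (Ioi_mem_nhds (show τ - δ < τ by linarith)),
      hb.eventually (Iio_mem_nhds (show τ < τ + δ by linarith)), self_mem_nhdsWithin]
      with x hx0 hx1 hx2 hx3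
    have hx3 : 0 < x := hx3
    have := H (b x) (a x) hx0 (by linarith [hab x]) hx1 hx2
    rw [hab x] at this
    rw [norm_smul, norm_inv, Real.norm_of_nonneg hx3.le, inv_mul_lt_iff₀ hx3]
    nlinarith
  have := h2.add h1
  rw [zero_add] at this
  refine this.congr fun x => ?_
  rw [← smul_add]; congr 1; abel

lemma tendsto_Ioi_id : Tendsto (fun x : ℝ => x) (𝓝[>] 0) (𝓝 0) := nhdsWithin_le_nhds

end

end KatoAux

/-- Kato's theorem (Pazy, Ch. 5, Theorem 3.1): a family `{A(t)}_{t≥0}` satisfying the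
hyperbolic conditions (Hyp1)–(Hyp3) determines a unique evolution system `{R(t,s)}` with
(i) `‖R(t,s)‖ ≤ M e^{ω(t−s)}`, (ii) `∂⁺/∂t R(t,s)v|_{t=s} = A(s)v` for `v ∈ V`, and
(iii) `∂/∂s R(t,s)v = −R(t,s)A(s)v` for `v ∈ V`, `0 ≤ s ≤ t`. -/
theorem kato_evolution_system
    {V E : Type*} [NormedAddCommGroup V] [NormedSpace ℝ V] [CompleteSpace V]
    [NormedAddCommGroup E] [NormedSpace ℝ E] [CompleteSpace E]
    (iota : V →L[ℝ] E) (hinj : Function.Injective iota) (hdense : DenseRange iota)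
    (A : ℝ → (V →L[ℝ] E)) (S : ℝ → ℝ → E →L[ℝ] E) (SV : ℝ → ℝ → V →L[ℝ] V)
    (M om MV omV : ℝ) (hM : 1 ≤ M) (hMV : 1 ≤ MV)
    (hhyp : IsHyperbolicFamily iota A S SV M om MV omV) :
    ∃ R : ℝ → ℝ → E →L[ℝ] E,
      IsDeterminedEvolutionSystem iota A M om R ∧
      ∀ R' : ℝ → ℝ → E →L[ℝ] E, IsDeterminedEvolutionSystem iota A M om R' →
        ∀ t s : ℝ, 0 ≤ s → s ≤ t → R' t s = R t s := by
  obtain ⟨R, hR⟩ := KatoAux.exists_lim hhyp hM hMV hdense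
  have hev := KatoAux.lim_evol hhyp hM hMV hdense hR
  have hbd := KatoAux.lim_bound hhyp hM hR
  have hder : ∀ s : ℝ, 0 ≤ s → ∀ v : V,
      Tendsto (fun h : ℝ => h⁻¹ • (R (s + h) s (iota v) - iota v)) (𝓝[>] 0) (𝓝 (A s v)) := by
    intro s hs v
    refine KatoAux.lim_quot hhyp hM hMV hR hs v (a := fun _ => s) (b := fun x => s + x)
      (fun x => by ring) tendsto_const_nhds
      ((KatoAux.tendsto_add_right s).mono_right nhdsWithin_le_nhds) (Eventually.of_forall fun _ => hs)
  refine ⟨R, ⟨hev, hbd, hder, ?_⟩, ?_⟩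
  · intro t v s hs
    have hpre := KatoAux.Pre_det hev hM hbd hder t
    have hleft : HasDerivWithinAt (fun σ : ℝ => R t σ (iota v)) (-(R t s (A s v))) (Icc 0 s) s := by
      rcases hs.1.eq_or_lt with h0 | h0
      · subst h0
        rw [Icc_self]; exact HasFDerivWithinAt.of_subsingleton subsingleton_singleton
      refine HasDerivWithinAt.mono ?_ (Icc_subset_Iic_self : Icc 0 s ⊆ Iic s)
      apply KatoAux.hasDeriv_left
      have hsub : Tendsto (fun x => s - x) (𝓝[>] 0) (𝓝 s) := by
        simpa using (tendsto_const_nhds (x := s)).sub KatoAux.tendsto_Ioi_id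
      have hnn : ∀ᶠ x in 𝓝[>] (0:ℝ), 0 ≤ s - x :=
        (hsub.eventually (Ioi_mem_nhds h0)).mono fun x hx => le_of_lt hx
      have := KatoAux.lim_quot hhyp hM hMV hR hs.1 v (a := fun x => s - x) (b := fun _ => s)
        (fun x => by ring) hsub tendsto_const_nhds hnn
      have h2 := (((R t s).continuous.tendsto _).comp this).neg
      refine h2.congr' ?_
      filter_upwards [hnn, self_mem_nhdsWithin] with x hx hx0
      have hx0 : 0 < x := hx0
      rw [← hev.2.1 t s (s - x) hx (by linarith) hs.2]
      simp only [Function.comp, map_smul, map_sub, ContinuousLinearMap.comp_apply]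
      rw [← smul_neg, neg_sub]
    have hright : HasDerivWithinAt (fun σ : ℝ => R t σ (iota v)) (-(R t s (A s v))) (Icc s t) s := by
      rcases hs.2.eq_or_lt with h0 | h0
      · subst h0
        rw [Icc_self]; exact HasFDerivWithinAt.of_subsingleton subsingleton_singleton
      refine HasDerivWithinAt.mono ?_ (Icc_subset_Ici_self : Icc s t ⊆ Ici s)
      have := hpre.right_deriv hs.1 h0 le_rfl (z := fun _ => iota v) (z' := 0) (v := v) rfl (by simp)
      simpa using this
    have := hleft.union hright
    rwa [Icc_union_Icc_eq_Icc hs.1 hs.2] at this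
  · rintro R' ⟨hev', hbd', hder', -⟩ t s hs hst
    have hpre := KatoAux.Pre_det hev' hM hbd' hder' t
    have hC := KatoAux.CC_pos (om := om) (T := t) hM
    have hCV := KatoAux.CC_pos (om := omV) (T := t) hMV
    have heq : (R' t s : E → E) = R t s := by
      refine hdense.equalizer (R' t s).continuous (R t s).continuous (funext fun v => ?_)
      refine tendsto_nhds_unique ?_ (hR t s hs hst (iota v))
      rw [Metric.tendsto_atTop']
      intro η hη
      obtain ⟨ε, hε, H⟩ := KatoAux.exists_eps
        (a := KatoAux.CC M om t * (KatoAux.CC MV omV t * ‖v‖)) (T := t) (by positivity)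
        (hs.trans hst) (show 0 < η / 2 by positivity)
      obtain ⟨N, hN⟩ := eventually_atTop.1 ((KatoAux.ev_le t).and
        (KatoAux.Bn_close hhyp.contA t hε))
      refine ⟨N, fun n hn => ?_⟩
      have key := KatoAux.Un_compare hhyp hM hMV (hN n hn.le).1 hpre (ε := ε) hs hst le_rfl
        (fun r hr hrt => (hN n hn.le).2 r ⟨hs.trans hr, hrt.le⟩) v
      have h2 := H (t - s) (by linarith) (by linarith)
      simp only [Function.comp]
      rw [dist_eq_norm]
      have : KatoAux.CC M om t * (ε * (KatoAux.CC MV omV t * ‖v‖)) * (t - s) =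
        ε * (KatoAux.CC M om t * (KatoAux.CC MV omV t * ‖v‖)) * (t - s) := by ring
      linarith
    exact DFunLike.coe_injective heq
end
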